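/- arXiv:1103.5030 — 2 statements merged into one kernel-verified Lean document; each statement's English description precedes it below -/
import Mathlib

section
/- Let f(x) = c_k x^k + ⋯ + c_0 ∈ ℤ[x] with c_k > 0 and k ≥ 1. Then Σ_{q=1}^{∞} (μ(q)²/(q·φ(q)²)) Σ_{0 ≤ a < q, gcd(a,q)=1} Σ_{r=0}^{q−1} e^{2πi f(r) a/q} = ∏_{p prime} (1 + (z_f(p) − 1)/(p − 1)²). -/
open Real Filter

/-- `zf f p` is the number of roots of `f` modulo `p`. -/
def zf (f : Polynomial ℤ) (p : ℕ) : ℕ :=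
  ((Finset.range p).filter fun r : ℕ => f.eval (r : ℤ) % (p : ℤ) = 0).card

/-- The complete exponential sum `S_{a/q} = Σ_{r=0}^{q−1} e^{2πi f(r) a/q}`. -/
noncomputable def Saq (f : Polynomial ℤ) (a : ℤ) (q : ℕ) : ℂ :=
  ∑ r ∈ Finset.range q,
    Complex.exp (2 * Real.pi * Complex.I * (f.eval (r : ℤ)) * a / q)

noncomputable def ee (q : ℕ) (x : ℤ) : ℂ := Complex.exp (2 * Real.pi * Complex.I * x / q)

lemma ee_add (q : ℕ) (x y : ℤ) : ee q (x + y) = ee q x * ee q y := by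
  unfold ee
  rw [← Complex.exp_add]
  congr 1
  push_cast
  ring

lemma ee_mul_self (q : ℕ) (hq : q ≠ 0) (t : ℤ) : ee q (q * t) = 1 := by
  unfold ee
  rw [Complex.exp_eq_one_iff]
  refine ⟨t, ?_⟩
  have : (q : ℂ) ≠ 0 := by exact_mod_cast hq
  push_cast
  field_simp

lemma ee_congr (q : ℕ) (hq : q ≠ 0) {x y : ℤ} (h : x ≡ y [ZMOD q]) : ee q x = ee q y := by
  obtain ⟨t, ht⟩ := h.symm.dvd
  have : x = y + q * t := by linarith
  rw [this, ee_add, ee_mul_self q hq, mul_one]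

lemma ee_eq_one_iff (q : ℕ) (hq : q ≠ 0) (x : ℤ) : ee q x = 1 ↔ (q : ℤ) ∣ x := by
  constructor
  · intro h
    unfold ee at h
    rw [Complex.exp_eq_one_iff] at h
    obtain ⟨n, hn⟩ := h
    refine ⟨n, ?_⟩
    have h1 : (q : ℂ) ≠ 0 := by exact_mod_cast hq
    have h2 := Complex.two_pi_I_ne_zero
    rw [div_eq_iff h1] at hn
    have h3 : (2 * Real.pi * Complex.I) * (x : ℂ) = (2 * Real.pi * Complex.I) * (q * n) := by
      rw [hn]; ring
    exact_mod_cast mul_left_cancel₀ h2 h3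
  · rintro ⟨t, rfl⟩
    exact ee_mul_self q hq t

lemma ee_mul_nat (q : ℕ) (x : ℤ) (n : ℕ) : ee q (x * n) = ee q x ^ n := by
  unfold ee
  rw [← Complex.exp_nat_mul]
  congr 1
  push_cast
  ring

lemma ee_scale (m n : ℕ) (hn : n ≠ 0) (x : ℤ) : ee (m * n) (x * n) = ee m x := by
  unfold ee
  have h1 : (n : ℂ) ≠ 0 := by exact_mod_cast hn
  congr 1
  push_cast
  rw [← mul_assoc, mul_div_mul_right _ _ h1]

lemma Saq_eq (f : Polynomial ℤ) (a : ℤ) (q : ℕ) :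
    Saq f a q = ∑ r ∈ Finset.range q, ee q (f.eval (r : ℤ) * a) := by
  unfold Saq ee
  refine Finset.sum_congr rfl fun r _ => ?_
  congr 1
  push_cast
  ring

lemma eval_modEq (f : Polynomial ℤ) (q : ℕ) {x y : ℤ} (h : x ≡ y [ZMOD q]) :
    f.eval x ≡ f.eval y [ZMOD q] := by
  refine (Int.modEq_iff_dvd.2 ?_)
  exact h.dvd.trans (Polynomial.sub_dvd_eval_sub _ _ _)

lemma Saq_congr (f : Polynomial ℤ) (q : ℕ) (hq : q ≠ 0) {a b : ℤ} (h : a ≡ b [ZMOD q]) :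
    Saq f a q = Saq f b q := by
  rw [Saq_eq, Saq_eq]
  exact Finset.sum_congr rfl fun r _ => ee_congr q hq (h.mul_left _)

lemma sum_crt (m n : ℕ) (hm : m ≠ 0) (hn : n ≠ 0) (h : Nat.Coprime m n) (G : ℕ → ℕ → ℂ) :
    ∑ r ∈ Finset.range (m * n), G (r % m) (r % n)
      = ∑ x ∈ Finset.range m, ∑ y ∈ Finset.range n, G x y := by
  rw [← Finset.sum_product']
  have hmaps : ∀ r ∈ Finset.range (m * n),
      (r % m, r % n) ∈ Finset.range m ×ˢ Finset.range n := by
    intro r _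
    simp only [Finset.mem_product, Finset.mem_range]
    exact ⟨Nat.mod_lt _ (Nat.pos_of_ne_zero hm), Nat.mod_lt _ (Nat.pos_of_ne_zero hn)⟩
  have hinj : Set.InjOn (fun r : ℕ => (r % m, r % n)) (Finset.range (m * n) : Set ℕ) := by
    intro r hr s hs hrs
    simp only [Finset.coe_range, Set.mem_Iio] at hr hs
    simp only [Prod.mk.injEq] at hrs
    have : r ≡ s [MOD m * n] := (Nat.modEq_and_modEq_iff_modEq_mul h).1 ⟨hrs.1, hrs.2⟩
    exact Nat.ModEq.eq_of_lt_of_lt this hr hs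
  refine Finset.sum_nbij (fun r => (r % m, r % n)) hmaps hinj ?_ (fun _ _ => rfl)
  exact Finset.surjOn_of_injOn_of_card_le _ hmaps hinj (by simp)

lemma Saq_mul (f : Polynomial ℤ) (m n : ℕ) (hm : m ≠ 0) (hn : n ≠ 0) (h : Nat.Coprime m n)
    (a b : ℤ) : Saq f (a * n + b * m) (m * n) = Saq f a m * Saq f b n := by
  rw [Saq_eq, Saq_eq, Saq_eq, Finset.sum_mul_sum, 
    ← sum_crt m n hm hn h (fun x y => ee m (f.eval (x : ℤ) * a) * ee n (f.eval (y : ℤ) * b))]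
  refine Finset.sum_congr rfl fun r _ => ?_
  have e1 : f.eval (r : ℤ) * (a * n + b * m) = f.eval (r : ℤ) * a * n + f.eval (r : ℤ) * b * m := by
    ring
  rw [e1, ee_add, ee_scale m n hn, mul_comm m n, ee_scale n m hm]
  congr 1
  · refine ee_congr m hm (Int.ModEq.mul_right _ (eval_modEq f m ?_))
    push_cast
    exact (Int.mod_modEq _ _).symm
  · refine ee_congr n hn (Int.ModEq.mul_right _ (eval_modEq f n ?_))
    push_cast
    exact (Int.mod_modEq _ _).symm

noncomputable def HH (f : Polynomial ℤ) (q : ℕ) : ℂ :=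
  ∑ a ∈ (Finset.range q).filter fun a => Nat.Coprime a q, Saq f (a : ℤ) q

lemma card_cop (q : ℕ) : ((Finset.range q).filter fun a => Nat.Coprime a q).card = q.totient := by
  rw [Nat.totient]
  congr 1
  refine Finset.filter_congr fun a _ => Nat.coprime_comm

lemma cop_aux (m n a b : ℕ) (h : Nat.Coprime m n) (ha : Nat.Coprime a m) :
    Nat.Coprime (a * n + b * m) m := by
  rw [Nat.coprime_add_mul_right_left]
  exact Nat.Coprime.mul_left ha h.symm

lemma inj_aux (m n a b c d : ℕ) (h : Nat.Coprime m n) (ha : a < m) (hc : c < m)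
    (e : a * n + b * m ≡ c * n + d * m [MOD m]) : a = c := by
  have h1 : a * n ≡ c * n [MOD m] := by
    have : ∀ x y : ℕ, x + y * m ≡ x [MOD m] := by
      intro x y
      simp [Nat.ModEq]
    exact ((this _ _).symm.trans e).trans (this _ _)
  exact Nat.ModEq.eq_of_lt_of_lt (Nat.ModEq.cancel_right_of_coprime h h1) ha hc

lemma HH_mul (f : Polynomial ℤ) (m n : ℕ) (hm : m ≠ 0) (hn : n ≠ 0) (h : Nat.Coprime m n) :
    HH f (m * n) = HH f m * HH f n := by
  unfold HH
  rw [Finset.sum_mul_sum, ← Finset.sum_product']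
  symm
  have hmaps : ∀ x ∈ ((Finset.range m).filter fun a => Nat.Coprime a m) ×ˢ
      ((Finset.range n).filter fun a => Nat.Coprime a n),
      (x.1 * n + x.2 * m) % (m * n) ∈
        (Finset.range (m * n)).filter fun a => Nat.Coprime a (m * n) := by
    rintro ⟨a, b⟩ hx
    simp only [Finset.mem_product, Finset.mem_filter, Finset.mem_range] at hx ⊢
    refine ⟨Nat.mod_lt _ (Nat.pos_of_ne_zero (mul_ne_zero hm hn)), ?_⟩
    have : Nat.Coprime (a * n + b * m) (m * n) := by
      refine Nat.Coprime.mul_right (cop_aux m n a b h hx.1.2) ?_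
      rw [add_comm]
      exact cop_aux n m b a h.symm hx.2.2
    rw [Nat.Coprime, ← Nat.gcd_rec, Nat.gcd_comm]
    exact this
  have hinj : Set.InjOn (fun x : ℕ × ℕ => (x.1 * n + x.2 * m) % (m * n))
      ((((Finset.range m).filter fun a => Nat.Coprime a m) ×ˢ
      ((Finset.range n).filter fun a => Nat.Coprime a n) : Finset (ℕ × ℕ)) : Set (ℕ × ℕ)) := by
    rintro ⟨a, b⟩ hx ⟨c, d⟩ hy hxy
    simp only [Finset.mem_coe, Finset.mem_product, Finset.mem_filter, Finset.mem_range] at hx hy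
    have hxy : a * n + b * m ≡ c * n + d * m [MOD m * n] := hxy
    have h1 := inj_aux m n a b c d h hx.1.1 hy.1.1 (hxy.of_mul_right n)
    have h2 : b = d := by
      refine inj_aux n m b a d c h.symm hx.2.1 hy.2.1 ?_
      have := hxy.of_mul_left m
      rwa [add_comm (a * n), add_comm (c * n)] at this
    rw [h1, h2]
  refine Finset.sum_nbij (fun x => (x.1 * n + x.2 * m) % (m * n)) hmaps hinj ?_ ?_
  · refine Finset.surjOn_of_injOn_of_card_le _ hmaps hinj ?_
    rw [Finset.card_product, card_cop, card_cop, card_cop, Nat.totient_mul h]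
  · rintro ⟨a, b⟩ _
    rw [← Saq_mul f m n hm hn h]
    refine Saq_congr f _ (mul_ne_zero hm hn) ?_
    push_cast
    exact (Int.mod_modEq _ _).symm

lemma HH_one (f : Polynomial ℤ) : HH f 1 = 1 := by
  simp [HH, Saq]

lemma HH_prime (f : Polynomial ℤ) (p : ℕ) (hp : p.Prime) :
    HH f p = p * ((zf f p : ℂ) - 1) := by
  have hp0 := hp.ne_zero
  have h1 : ∑ a ∈ Finset.range p, Saq f (a : ℤ) p = Saq f 0 p + HH f p := by
    have : Finset.range p
        = insert 0 ((Finset.range p).filter fun a => Nat.Coprime a p) := by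
      ext a
      simp only [Finset.mem_range, Finset.mem_insert, Finset.mem_filter]
      constructor
      · intro ha
        rcases Nat.eq_zero_or_pos a with h | h
        · exact Or.inl h
        · exact Or.inr ⟨ha, ((Nat.Prime.coprime_iff_not_dvd hp).2 (Nat.not_dvd_of_pos_of_lt h ha)).symm⟩
      · rintro (h | h)
        · rw [h]; exact hp.pos
        · exact h.1
    conv_lhs => rw [this]
    rw [Finset.sum_insert]
    · rfl
    · simp [hp.ne_one]
  have h2 : Saq f 0 p = p := by
    simp [Saq]
  have h3 : ∑ a ∈ Finset.range p, Saq f (a : ℤ) p = p * zf f p := by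
    simp_rw [Saq_eq]
    rw [Finset.sum_comm]
    have : ∀ r ∈ Finset.range p, ∑ a ∈ Finset.range p, ee p (f.eval (r : ℤ) * (a : ℤ))
        = if f.eval (r : ℤ) % (p : ℤ) = 0 then (p : ℂ) else 0 := by
      intro r _
      simp_rw [ee_mul_nat]
      split_ifs with h
      · rw [(ee_eq_one_iff p hp0 _).2 (Int.dvd_of_emod_eq_zero h)]
        simp
      · have hne : ee p (f.eval (r : ℤ)) ≠ 1 := by
          intro h'
          exact h (Int.emod_eq_zero_of_dvd ((ee_eq_one_iff p hp0 _).1 h'))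
        have := mul_geom_sum (ee p (f.eval (r : ℤ))) p
        rw [← ee_mul_nat, mul_comm _ (p : ℤ), ee_mul_self p hp0, sub_self] at this
        exact (mul_eq_zero.1 this).resolve_left (sub_ne_zero.2 hne)
    rw [Finset.sum_congr rfl this, ← Finset.sum_filter, Finset.sum_const, zf, nsmul_eq_mul, mul_comm]
  rw [h3, h2] at h1
  linear_combination -h1

noncomputable def FF (f : Polynomial ℤ) (q : ℕ) : ℂ :=
  ((((ArithmeticFunction.moebius q : ℝ) ^ 2 /
          ((q : ℝ) * (Nat.totient q : ℝ) ^ 2)) : ℝ) : ℂ) * HH f q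

noncomputable def gg (f : Polynomial ℤ) (p : ℕ) : ℝ :=
  ((zf f p : ℝ) - 1) / ((p : ℝ) - 1) ^ 2

lemma FF_mul (f : Polynomial ℤ) (m n : ℕ) (hm : m ≠ 0) (hn : n ≠ 0) (h : Nat.Coprime m n) :
    FF f (m * n) = FF f m * FF f n := by
  unfold FF
  rw [HH_mul f m n hm hn h, ArithmeticFunction.isMultiplicative_moebius.map_mul_of_coprime h,
    Nat.totient_mul h]
  push_cast
  rw [mul_mul_mul_comm, div_mul_div_comm]
  congr 2 <;> ring

lemma FF_one (f : Polynomial ℤ) : FF f 1 = 1 := by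
  simp [FF, HH_one]

lemma FF_prime (f : Polynomial ℤ) (p : ℕ) (hp : p.Prime) : FF f p = (gg f p : ℂ) := by
  unfold FF gg
  rw [HH_prime f p hp, ArithmeticFunction.moebius_apply_prime hp, Nat.totient_prime hp,
    Nat.cast_sub hp.one_le]
  have h0 : (p : ℂ) ≠ 0 := by exact_mod_cast hp.ne_zero
  have h1 : (p : ℂ) - 1 ≠ 0 := by
    rw [sub_ne_zero]; exact_mod_cast hp.ne_one
  push_cast
  field_simp

lemma FF_prod (f : Polynomial ℤ) (s : Finset Nat.Primes) :
    FF f (∏ p ∈ s, (p : ℕ)) = ∏ p ∈ s, (gg f (p : ℕ) : ℂ) := by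
  classical
  induction s using Finset.induction_on with
  | empty => simp [FF_one]
  | insert p s hps ih =>
    rw [Finset.prod_insert hps, Finset.prod_insert hps, FF_mul, ih, FF_prime f p p.2]
    · exact p.2.ne_zero
    · exact Finset.prod_ne_zero_iff.2 fun q _ => q.2.ne_zero
    · refine Nat.Coprime.prod_right fun q hq => ?_
      refine (Nat.coprime_primes p.2 q.2).2 fun h => ?_
      exact hps (by rwa [Subtype.ext h])

lemma prod_inj : Function.Injective (fun s : Finset Nat.Primes => ∏ p ∈ s, (p : ℕ)) := by
  classical
  have key : ∀ (s : Finset Nat.Primes) (p : Nat.Primes), p ∈ s ↔ (p : ℕ) ∣ ∏ q ∈ s, (q : ℕ) := by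
    intro s p
    constructor
    · intro h
      exact Finset.dvd_prod_of_mem (fun q : Nat.Primes => (q : ℕ)) h
    · intro h
      obtain ⟨q, hq, hpq⟩ := (p.2.prime.dvd_finset_prod_iff _).1 h
      rwa [Subtype.ext ((Nat.prime_dvd_prime_iff_eq p.2 q.2).1 hpq)]
  intro s t h
  ext p
  have h : ∏ p ∈ s, (p : ℕ) = ∏ p ∈ t, (p : ℕ) := h
  rw [key, key, h]

lemma supp_FF (f : Polynomial ℤ) :
    Function.support (FF f) ⊆ Set.range (fun s : Finset Nat.Primes => ∏ p ∈ s, (p : ℕ)) := by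
  intro q hq
  have hsq : Squarefree q := by
    by_contra h
    apply hq
    simp [FF, ArithmeticFunction.moebius_eq_zero_of_not_squarefree h]
  refine ⟨q.primeFactors.subtype Nat.Prime, ?_⟩
  have := Finset.prod_subtype_of_mem (s := q.primeFactors) (p := Nat.Prime) (fun n : ℕ => n)
    (fun x hx => Nat.prime_of_mem_primeFactors hx)
  exact this.trans (Nat.prod_primeFactors_of_squarefree hsq)

lemma zf_le (f : Polynomial ℤ) (p : ℕ) (hp : p.Prime) (h : ¬ (p : ℤ) ∣ f.leadingCoeff) :
    zf f p ≤ f.natDegree := by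
  haveI := Fact.mk hp
  have hne : f.map (Int.castRingHom (ZMod p)) ≠ 0 := by
    intro h0
    apply h
    have := congrArg (fun g => Polynomial.coeff g f.natDegree) h0
    simp only [Polynomial.coeff_map, Polynomial.coeff_zero, eq_intCast] at this
    exact (ZMod.intCast_zmod_eq_zero_iff_dvd _ _).1 this
  unfold zf
  classical
  calc _ ≤ (f.map (Int.castRingHom (ZMod p))).roots.toFinset.card := by
        refine Finset.card_le_card_of_injOn (fun r : ℕ => (r : ZMod p)) ?_ ?_
        · intro r hr
          simp only [Finset.coe_filter, Set.mem_setOf_eq] at hr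
          simp only [Finset.mem_coe, Multiset.mem_toFinset]
          rw [Polynomial.mem_roots hne, Polynomial.IsRoot.def]
          have := Polynomial.eval_intCast_map (Int.castRingHom (ZMod p)) f (r : ℤ)
          simp only [Int.cast_natCast, eq_intCast] at this
          rw [this, ZMod.intCast_zmod_eq_zero_iff_dvd]
          exact Int.dvd_of_emod_eq_zero hr.2
        · intro r hr s hs hrs
          simp only [Finset.coe_filter, Set.mem_setOf_eq, Finset.mem_range] at hr hs
          exact Nat.ModEq.eq_of_lt_of_lt ((ZMod.natCast_eq_natCast_iff _ _ _).1 hrs) hr.1 hs.1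
    _ ≤ _ := Multiset.toFinset_card_le _
    _ ≤ _ := Polynomial.card_roots' _
    _ ≤ _ := Polynomial.natDegree_map_le

lemma gg_summable (f : Polynomial ℤ) (hlead : 0 < f.leadingCoeff) :
    Summable (fun p : Nat.Primes => ‖gg f (p : ℕ)‖) := by
  have hs : Summable (fun p : Nat.Primes => 4 * ((f.natDegree : ℝ) + 1) * (1 / ((p : ℕ) : ℝ) ^ 2)) :=
    ((Real.summable_one_div_nat_pow.2 one_lt_two).comp_injective
      Subtype.val_injective).mul_left _
  refine Summable.of_norm_bounded_eventually hs ?_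
  have hfin : Set.Finite {p : Nat.Primes | ((p : ℕ) : ℤ) ≤ f.leadingCoeff} := by
    refine Set.Finite.of_finite_image (f := fun p : Nat.Primes => (p : ℕ)) ?_
      Subtype.val_injective.injOn
    refine (Set.finite_Iic f.leadingCoeff.toNat).subset ?_
    rintro _ ⟨p, hp, rfl⟩
    simp only [Set.mem_setOf_eq] at hp
    simp only [Set.mem_Iic]
    omega
  filter_upwards [hfin.compl_mem_cofinite] with p hp
  simp only [Set.mem_compl_iff, Set.mem_setOf_eq, not_le] at hp
  have hz : (zf f p : ℝ) ≤ f.natDegree := by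
    exact_mod_cast zf_le f p p.2 fun h => absurd (Int.le_of_dvd hlead h) (by omega)
  have hz0 : (0 : ℝ) ≤ zf f p := Nat.cast_nonneg _
  have hp2 : (2 : ℝ) ≤ ((p : ℕ) : ℝ) := by exact_mod_cast p.2.two_le
  rw [norm_norm, gg, norm_div, Real.norm_eq_abs, Real.norm_eq_abs, abs_of_nonneg (sq_nonneg (((p : ℕ) : ℝ) - 1)),
    mul_one_div, div_le_div_iff₀ (by nlinarith) (by nlinarith)]
  have h1 : |(zf f p : ℝ) - 1| ≤ f.natDegree + 1 := by
    rw [abs_le]; constructor <;> linarith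
  have h2 : ((p : ℕ) : ℝ) ^ 2 ≤ 4 * (((p : ℕ) : ℝ) - 1) ^ 2 := by nlinarith
  calc _ ≤ ((f.natDegree : ℝ) + 1) * (4 * (((p : ℕ) : ℝ) - 1) ^ 2) :=
        mul_le_mul h1 h2 (by positivity) (by positivity)
    _ = _ := by ring


theorem stmt3 (f : Polynomial ℤ) (k : ℕ) (hk : 1 ≤ k)
    (hdeg : f.natDegree = k) (hlead : 0 < f.leadingCoeff) :
    (∑' q : ℕ,
      ((((ArithmeticFunction.moebius q : ℝ) ^ 2 /
          ((q : ℝ) * (Nat.totient q : ℝ) ^ 2)) : ℝ) : ℂ) *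
        ∑ a ∈ (Finset.range q).filter fun a => Nat.Coprime a q, Saq f (a : ℤ) q)
      =
    ((∏' p : Nat.Primes, (1 + ((zf f (p : ℕ) : ℝ) - 1) / (((p : ℕ) : ℝ) - 1) ^ 2) : ℝ) : ℂ) := by

  change ∑' q : ℕ, FF f q = ((∏' p : Nat.Primes, (1 + gg f (p : ℕ)) : ℝ) : ℂ)
  rw [tprod_one_add (summable_finsetProd_of_summable_norm (gg_summable f hlead)),
    Complex.ofReal_tsum, ← prod_inj.tsum_eq (supp_FF f)]
  refine tsum_congr fun s => ?_
  rw [FF_prod]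
  push_cast
  rfl
end

section
/- Let f(x) = c_k x^k + ⋯ + c_0 ∈ ℤ[x] with c_k > 0 and k ≥ 1. Then r_f(N) = R_f(N)/log² N + O(N^{(k+1)/k} · log log N / log³ N), where the implied constant depends only on f. -/
open Real Filter Asymptotics

/-- Truncated von Mangoldt function: `Λ_N(n) = log p` if `n = p^j ≤ N`, else `0`. -/
noncomputable def LamN (N : ℕ) (n : ℤ) : ℝ :=
  if 1 ≤ n ∧ n ≤ (N : ℤ) then ArithmeticFunction.vonMangoldt n.toNat else 0

/-- `M = (N/c_k)^{1/k}`. -/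
noncomputable def Mf (f : Polynomial ℤ) (k : ℕ) (N : ℕ) : ℕ :=
  ⌊((N : ℝ) / (f.leadingCoeff : ℝ)) ^ ((1 : ℝ) / k)⌋₊

/-- `R_f(N) = Σ_{d=1}^{M} Σ_{n∈ℤ} Λ_N(n) Λ_N(n − f(d))` with `M = (N/c_k)^{1/k}`. -/
noncomputable def Rf (f : Polynomial ℤ) (k : ℕ) (N : ℕ) : ℝ :=
  ∑ d ∈ Finset.Icc 1 (Mf f k N), ∑' n : ℤ, LamN N n * LamN N (n - f.eval (d : ℤ))

/-- `r_f(N) = #{(p₁,p₂) ∈ 𝒫_N² : p₁ − p₂ ∈ f(ℕ)}`. -/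
noncomputable def rf (f : Polynomial ℤ) (N : ℕ) : ℕ :=
  Nat.card {pq : ℕ × ℕ // pq.1.Prime ∧ pq.1 ≤ N ∧ pq.2.Prime ∧ pq.2 ≤ N ∧
    ∃ d : ℕ, 0 < d ∧ f.eval (d : ℤ) = (pq.1 : ℤ) - (pq.2 : ℤ)}


/-- Selberg sum. -/
noncomputable def selS (s : BoundingSieve) (z : ℕ) : ℝ :=
  ∑ l ∈ s.prodPrimes.divisors, if l ≤ z then s.selbergTerms l else 0

/-- Selberg weights. -/
noncomputable def selW (s : BoundingSieve) (z : ℕ) (d : ℕ) : ℝ :=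
  (s.nu d)⁻¹ * ((selS s z)⁻¹ * ((ArithmeticFunction.moebius d : ℤ) : ℝ) *
    ∑ l ∈ s.prodPrimes.divisors, if d ∣ l then (if l ≤ z then s.selbergTerms l else 0) else 0)

lemma selterm_nonneg (s : BoundingSieve) (z l : ℕ) (hl : l ∈ s.prodPrimes.divisors) :
    0 ≤ (if l ≤ z then s.selbergTerms l else 0) := by
  split_ifs
  · exact (BoundingSieve.selbergTerms_pos (Nat.dvd_of_mem_divisors hl)).le
  · rfl

lemma selS_pos (s : BoundingSieve) (z : ℕ) (hz : 1 ≤ z) : 0 < selS s z := by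
  unfold selS
  have h1 : 1 ∈ s.prodPrimes.divisors := by
    simp [BoundingSieve.prodPrimes_ne_zero]
  refine lt_of_lt_of_le ?_ (Finset.single_le_sum (f := fun l => if l ≤ z then s.selbergTerms l else 0)
    (fun l hl => selterm_nonneg s z l hl) h1)
  simp only [hz, if_true]
  exact BoundingSieve.selbergTerms_pos (one_dvd _)

lemma selW_one (s : BoundingSieve) (z : ℕ) (hz : 1 ≤ z) : selW s z 1 = 1 := by
  have := selS_pos s z hz
  unfold selW
  rw [s.nu_mult.map_one]
  simp only [one_dvd, if_true]
  change _ * (_ * _ * selS s z) = 1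
  simp
  field_simp

lemma selW_zero (s : BoundingSieve) (z d : ℕ) (hd : z < d) : selW s z d = 0 := by
  unfold selW
  rw [Finset.sum_eq_zero, mul_zero, mul_zero]
  intro l hl
  split_ifs with h1 h2
  · exfalso
    have := Nat.le_of_dvd (Nat.pos_of_mem_divisors hl) h1
    omega
  · rfl
  · rfl

lemma selW_le (s : BoundingSieve) (z d : ℕ) (hz : 1 ≤ z) (hd : d ∣ s.prodPrimes) :
    |selW s z d| ≤ (s.nu d)⁻¹ := by
  have hS := selS_pos s z hz
  have hn := BoundingSieve.nu_pos_of_dvd_prodPrimes hd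
  unfold selW
  rw [abs_mul, abs_of_pos (inv_pos.2 hn)]
  apply mul_le_of_le_one_right (inv_pos.2 hn).le
  rw [abs_mul, abs_mul, abs_of_pos (inv_pos.2 hS)]
  have h1 : |((ArithmeticFunction.moebius d : ℤ) : ℝ)| ≤ 1 := by
    exact_mod_cast ArithmeticFunction.abs_moebius_le_one
  have h2 : 0 ≤ ∑ l ∈ s.prodPrimes.divisors, (if d ∣ l then (if l ≤ z then s.selbergTerms l else 0) else 0) := by
    apply Finset.sum_nonneg
    intro l hl
    split_ifs with h1 h2
    · exact (BoundingSieve.selbergTerms_pos (Nat.dvd_of_mem_divisors hl)).le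
    · rfl
    · rfl
  have h3 : ∑ l ∈ s.prodPrimes.divisors, (if d ∣ l then (if l ≤ z then s.selbergTerms l else 0) else 0) ≤ selS s z := by
    apply Finset.sum_le_sum
    intro l hl
    have := selterm_nonneg s z l hl
    split_ifs at * <;> linarith
  rw [abs_of_nonneg h2]
  calc (selS s z)⁻¹ * |((ArithmeticFunction.moebius d : ℤ) : ℝ)| * _ ≤ (selS s z)⁻¹ * 1 * selS s z := by
        gcongr
    _ = 1 := by field_simp

lemma moebius_between (l m : ℕ) (hl : Squarefree l) (P : ℕ) (hP : P ≠ 0) (hlP : l ∣ P) :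
    ∑ d ∈ P.divisors, (if m ∣ d ∧ d ∣ l then ((ArithmeticFunction.moebius d : ℤ) : ℝ) else 0) =
      if l = m then ((ArithmeticFunction.moebius m : ℤ) : ℝ) else 0 := by
  by_cases hml : m ∣ l
  swap
  · rw [Finset.sum_eq_zero]
    · rw [if_neg]
      rintro rfl; exact hml dvd_rfl
    · intro d _
      rw [if_neg]
      rintro ⟨h1, h2⟩; exact hml (h1.trans h2)
  obtain ⟨q, rfl⟩ := hml
  have hm0 : m ≠ 0 := by rintro rfl; simp at hl
  have hq0 : q ≠ 0 := by rintro rfl; simp at hl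
  have hcop : m.Coprime q := Nat.coprime_of_squarefree_mul hl
  have key : ∑ d ∈ P.divisors, (if m ∣ d ∧ d ∣ m * q then ((ArithmeticFunction.moebius d : ℤ) : ℝ) else 0)
      = ∑ e ∈ q.divisors, ((ArithmeticFunction.moebius (m * e) : ℤ) : ℝ) := by
    rw [← Finset.sum_filter]
    symm
    apply Finset.sum_bij (fun e _ => m * e)
    · intro e he
      have := Nat.dvd_of_mem_divisors he
      simp only [Finset.mem_filter, Nat.mem_divisors]
      exact ⟨⟨(Nat.mul_dvd_mul_left m this).trans hlP, hP⟩, dvd_mul_right _ _, Nat.mul_dvd_mul_left m this⟩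
    · intro a _ b _ hab
      exact Nat.eq_of_mul_eq_mul_left (Nat.pos_of_ne_zero hm0) hab
    · intro d hd
      simp only [Finset.mem_filter, Nat.mem_divisors] at hd
      obtain ⟨_, ⟨e, rfl⟩, h⟩ := hd
      exact ⟨e, by simp [hq0, Nat.dvd_of_mul_dvd_mul_left (Nat.pos_of_ne_zero hm0) h], rfl⟩
    · intros; rfl
  rw [key]
  have : ∀ e ∈ q.divisors, ((ArithmeticFunction.moebius (m * e) : ℤ) : ℝ) =
      (ArithmeticFunction.moebius m : ℤ) * ((ArithmeticFunction.moebius e : ℤ) : ℝ) := by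
    intro e he
    rw [ArithmeticFunction.isMultiplicative_moebius.map_mul_of_coprime
      (hcop.coprime_dvd_right (Nat.dvd_of_mem_divisors he))]
    push_cast; rfl
  rw [Finset.sum_congr rfl this, ← Finset.mul_sum]
  have h2 : ∑ e ∈ q.divisors, ((ArithmeticFunction.moebius e : ℤ) : ℝ) = if q = 1 then 1 else 0 := by
    have := congrArg (fun F : ArithmeticFunction ℤ => F q) ArithmeticFunction.coe_zeta_mul_moebius
    simp only [ArithmeticFunction.coe_zeta_mul_apply, ArithmeticFunction.one_apply] at this
    exact_mod_cast this
  rw [h2]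
  by_cases h : q = 1
  · simp [h]
  · have : m * q ≠ m := by
      intro h'
      exact h (Nat.eq_of_mul_eq_mul_left (Nat.pos_of_ne_zero hm0) (by simpa using h'))
    simp [h, this]

lemma selW_diag (s : BoundingSieve) (z m : ℕ) (hm : m ∈ s.prodPrimes.divisors) :
    (∑ d ∈ s.prodPrimes.divisors, if m ∣ d then s.nu d * selW s z d else 0) =
      (selS s z)⁻¹ * ((ArithmeticFunction.moebius m : ℤ) : ℝ) * (if m ≤ z then s.selbergTerms m else 0) := by
  have h1 : ∀ d ∈ s.prodPrimes.divisors, (if m ∣ d then s.nu d * selW s z d else 0) =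
      ∑ l ∈ s.prodPrimes.divisors, (selS s z)⁻¹ * (if l ≤ z then s.selbergTerms l else 0) *
        (if m ∣ d ∧ d ∣ l then ((ArithmeticFunction.moebius d : ℤ) : ℝ) else 0) := by
    intro d hd
    have hn := BoundingSieve.nu_ne_zero (s := s) (Nat.dvd_of_mem_divisors hd)
    by_cases h : m ∣ d
    · simp only [h, if_true, true_and]
      unfold selW
      rw [mul_inv_cancel_left₀ hn, Finset.mul_sum]
      apply Finset.sum_congr rfl
      intro l _
      by_cases h2 : d ∣ l <;> simp [h2]
      ring
    · simp [h]
  rw [Finset.sum_congr rfl h1, Finset.sum_comm]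
  simp_rw [← Finset.mul_sum]
  rw [Finset.sum_congr rfl (fun l hl => by
    rw [moebius_between l m (BoundingSieve.squarefree_of_mem_divisors_prodPrimes hl) s.prodPrimes
      BoundingSieve.prodPrimes_ne_zero (Nat.dvd_of_mem_divisors hl)])]
  simp only [mul_ite, mul_zero]
  rw [Finset.sum_ite_eq' _ m]
  simp only [hm, if_true]
  split_ifs <;> ring

lemma sel_main (s : BoundingSieve) (z : ℕ) (hz : 1 ≤ z) :
    s.mainSum (BoundingSieve.lambdaSquared (selW s z)) = (selS s z)⁻¹ := by
  have hS := selS_pos s z hz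
  rw [BoundingSieve.mainSum_lambdaSquared_eq_sum_mul_sum_sq]
  have : ∀ l ∈ s.prodPrimes.divisors, (s.selbergTerms l)⁻¹ *
        (∑ d ∈ s.prodPrimes.divisors, if l ∣ d then s.nu d * selW s z d else 0) ^ 2
        = (selS s z)⁻¹ ^ 2 * (if l ≤ z then s.selbergTerms l else 0) := by
    intro l hl
    rw [selW_diag s z l hl]
    have hg := BoundingSieve.selbergTerms_pos (s := s) (Nat.dvd_of_mem_divisors hl)
    have hm : ((ArithmeticFunction.moebius l : ℤ) : ℝ) ^ 2 = 1 := by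
      have := ArithmeticFunction.moebius_sq_eq_one_of_squarefree
        (BoundingSieve.squarefree_of_mem_divisors_prodPrimes hl)
      exact_mod_cast this
    rw [mul_pow, mul_pow, hm]
    split_ifs
    · field_simp
    · simp
  rw [Finset.sum_congr rfl this, ← Finset.mul_sum]
  change _ * selS s z = _
  field_simp

lemma sel_err (s : BoundingSieve) (z : ℕ) (hz : 1 ≤ z)
    (hν : ∀ d, d ∣ s.prodPrimes → (s.nu d)⁻¹ ≤ d)
    (hrem : ∀ d, d ∣ s.prodPrimes → |s.rem d| ≤ d) :
    s.errSum (BoundingSieve.lambdaSquared (selW s z)) ≤ (z : ℝ) ^ 8 := by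
  have hw : ∀ d, d ∣ s.prodPrimes → |selW s z d| ≤ if d ≤ z then (z : ℝ) else 0 := by
    intro d hd
    split_ifs with h
    · exact (selW_le s z d hz hd).trans ((hν d hd).trans (by exact_mod_cast h))
    · rw [selW_zero s z d (by omega)]; simp
  have hlam0 : ∀ d, z ^ 2 < d → d ∣ s.prodPrimes → BoundingSieve.lambdaSquared (selW s z) d = 0 := by
    intro d hd hdP
    unfold BoundingSieve.lambdaSquared
    apply Finset.sum_eq_zero
    intro d1 h1
    apply Finset.sum_eq_zero
    intro d2 h2
    split_ifs with h
    · by_cases hz1 : z < d1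
      · rw [selW_zero s z d1 hz1, zero_mul]
      by_cases hz2 : z < d2
      · rw [selW_zero s z d2 hz2, mul_zero]
      exfalso
      have : d1.lcm d2 ≤ d1 * d2 := Nat.le_of_dvd (Nat.mul_pos (Nat.pos_of_mem_divisors h1) (Nat.pos_of_mem_divisors h2)) (Nat.lcm_dvd_mul d1 d2)
      have : d1 * d2 ≤ z * z := Nat.mul_le_mul (by omega) (by omega)
      rw [pow_two] at hd
      omega
    · rfl
  have hsum : ∀ d, d ∣ s.prodPrimes → ∑ e ∈ d.divisors, |selW s z e| ≤ (z : ℝ) ^ 2 := by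
    intro d hd
    calc ∑ e ∈ d.divisors, |selW s z e| ≤ ∑ e ∈ d.divisors, (if e ≤ z then (z : ℝ) else 0) :=
          Finset.sum_le_sum fun e he => hw e ((Nat.dvd_of_mem_divisors he).trans hd)
      _ = ∑ e ∈ d.divisors.filter (· ≤ z), (z : ℝ) := by rw [Finset.sum_filter]
      _ ≤ ∑ e ∈ Finset.Icc 1 z, (z : ℝ) := by
          apply Finset.sum_le_sum_of_subset_of_nonneg
          · intro e he
            simp only [Finset.mem_filter] at he
            simp only [Finset.mem_Icc]
            exact ⟨Nat.pos_of_mem_divisors he.1, he.2⟩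
          · intros; positivity
      _ = (z : ℝ) ^ 2 := by simp; ring
  have hlam : ∀ d, d ∣ s.prodPrimes → |BoundingSieve.lambdaSquared (selW s z) d| ≤ (z : ℝ) ^ 4 := by
    intro d hd
    unfold BoundingSieve.lambdaSquared
    calc _ ≤ ∑ d1 ∈ d.divisors, ∑ d2 ∈ d.divisors, |selW s z d1| * |selW s z d2| := by
          refine (Finset.abs_sum_le_sum_abs _ _).trans (Finset.sum_le_sum fun d1 _ => ?_)
          refine (Finset.abs_sum_le_sum_abs _ _).trans (Finset.sum_le_sum fun d2 _ => ?_)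
          split_ifs
          · rw [abs_mul]
          · simp; positivity
      _ = (∑ e ∈ d.divisors, |selW s z e|) ^ 2 := by rw [sq, Finset.sum_mul_sum]
      _ ≤ ((z : ℝ) ^ 2) ^ 2 := by
          have := hsum d hd
          have h0 : 0 ≤ ∑ e ∈ d.divisors, |selW s z e| := Finset.sum_nonneg fun _ _ => abs_nonneg _
          gcongr
      _ = _ := by ring
  unfold BoundingSieve.errSum
  calc _ ≤ ∑ d ∈ s.prodPrimes.divisors, (if d ≤ z ^ 2 then (z : ℝ) ^ 6 else 0) := by
        apply Finset.sum_le_sum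
        intro d hd
        have hdP := Nat.dvd_of_mem_divisors hd
        split_ifs with h
        · calc _ ≤ (z : ℝ) ^ 4 * (z : ℝ) ^ 2 := by
                have : (d : ℝ) ≤ (z : ℝ) ^ 2 := by exact_mod_cast h
                exact mul_le_mul (hlam d hdP) ((hrem d hdP).trans this) (abs_nonneg _) (by positivity)
            _ = _ := by ring
        · rw [hlam0 d (by omega) hdP]; simp
    _ = ∑ d ∈ s.prodPrimes.divisors.filter (· ≤ z ^ 2), (z : ℝ) ^ 6 := by rw [Finset.sum_filter]
    _ ≤ ∑ d ∈ Finset.Icc 1 (z ^ 2), (z : ℝ) ^ 6 := by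
          apply Finset.sum_le_sum_of_subset_of_nonneg
          · intro e he
            simp only [Finset.mem_filter] at he
            simp only [Finset.mem_Icc]
            exact ⟨Nat.pos_of_mem_divisors he.1, he.2⟩
          · intros; positivity
    _ = (z : ℝ) ^ 8 := by simp; ring

theorem selberg_bound (s : BoundingSieve) (z : ℕ) (hz : 1 ≤ z)
    (hν : ∀ d, d ∣ s.prodPrimes → (s.nu d)⁻¹ ≤ d)
    (hrem : ∀ d, d ∣ s.prodPrimes → |s.rem d| ≤ d) :
    s.siftedSum ≤ s.totalMass / selS s z + (z : ℝ) ^ 8 := by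
  have := BoundingSieve.siftedSum_le_mainSum_errSum_of_upperMoebius (s := s) _
    (BoundingSieve.upperMoebius_lambdaSquared (selW s z) (selW_one s z hz))
  rw [sel_main s z hz] at this
  have h2 := sel_err s z hz hν hrem
  rw [div_eq_mul_inv]
  linarith
/-- root count mod d -/
noncomputable def rootN (h d : ℕ) : ℕ := Nat.card {x : ZMod d // x * (x + (h : ZMod d)) = 0}

/-- product over primes of local densities numerators -/
def rhoF (h d : ℕ) : ℕ := ∏ p ∈ d.primeFactors, (if p ∣ h then 1 else 2)

lemma rootN_mul (h m n : ℕ) (hc : m.Coprime n) : rootN h (m * n) = rootN h m * rootN h n := by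
  unfold rootN
  rw [← Nat.card_prod]
  apply Nat.card_congr
  refine Equiv.trans (Equiv.subtypeEquiv (q := fun c : ZMod m × ZMod n =>
    c.1 * (c.1 + (h : ZMod m)) = 0 ∧ c.2 * (c.2 + (h : ZMod n)) = 0)
    (ZMod.chineseRemainder hc).toEquiv ?_)
    (Equiv.subtypeProdEquivProd (p := fun x : ZMod m => x * (x + (h : ZMod m)) = 0)
      (q := fun x : ZMod n => x * (x + (h : ZMod n)) = 0))
  intro a
  have key : (ZMod.chineseRemainder hc) (a * (a + (h : ZMod (m * n)))) =
      (((ZMod.chineseRemainder hc) a).1 * (((ZMod.chineseRemainder hc) a).1 + (h : ZMod m)),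
       ((ZMod.chineseRemainder hc) a).2 * (((ZMod.chineseRemainder hc) a).2 + (h : ZMod n))) := by
    rw [map_mul, map_add, map_natCast]
    rfl
  rw [← (ZMod.chineseRemainder hc).map_eq_zero_iff, key, Prod.mk_eq_zero]
  rfl

lemma rootN_prime (h p : ℕ) (hp : p.Prime) : rootN h p = if p ∣ h then 1 else 2 := by
  have := Fact.mk hp
  unfold rootN
  have : ∀ x : ZMod p, x * (x + (h : ZMod p)) = 0 ↔ x ∈ ({0, -(h : ZMod p)} : Finset (ZMod p)) := by
    intro x
    rw [mul_eq_zero, add_eq_zero_iff_eq_neg]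
    simp
  simp_rw [this]
  rw [Nat.card_eq_fintype_card, Fintype.card_coe]
  split_ifs with hd
  · rw [(ZMod.natCast_eq_zero_iff h p).2 hd]
    simp
  · rw [Finset.card_pair]
    intro h0
    apply hd
    rw [← ZMod.natCast_eq_zero_iff]
    exact neg_eq_zero.1 h0.symm

lemma rhoF_mul (h m n : ℕ) (hc : m.Coprime n) : rhoF h (m * n) = rhoF h m * rhoF h n := by
  unfold rhoF
  rw [hc.primeFactors_mul, Finset.prod_union hc.disjoint_primeFactors]

lemma rootN_eq (h d : ℕ) (hd : Squarefree d) : rootN h d = rhoF h d := by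
  induction d using Nat.recOnPosPrimePosCoprime with
  | zero => simp at hd
  | one =>
    unfold rootN rhoF
    simp only [Nat.primeFactors_one, Finset.prod_empty]
    rw [Nat.card_eq_one_iff_unique]
    refine ⟨⟨fun a b => Subtype.ext (Subsingleton.elim (α := ZMod 1) _ _)⟩, ⟨⟨0, by simp⟩⟩⟩
  | prime_pow p n hp hn =>
    have : n = 1 := by
      by_contra hne
      have := (Nat.squarefree_pow_iff hp.ne_one (by omega)).1 hd
      exact hne this.2
    subst this
    rw [pow_one, rootN_prime h p hp]
    unfold rhoF
    rw [hp.primeFactors]; simp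
  | coprime a b ha hb hc iha ihb =>
    rw [rootN_mul h a b hc, rhoF_mul h a b hc, iha (hd.of_mul_left), ihb (hd.of_mul_right)]

lemma rootN_count (h d : ℕ) (hd : d ≠ 0) : d.count (fun n => d ∣ n * (n + h)) = rootN h d := by
  have : NeZero d := ⟨hd⟩
  rw [Nat.count_eq_card_filter_range]
  unfold rootN
  rw [Nat.card_eq_fintype_card, Fintype.card_subtype]
  apply Finset.card_bij (fun (n : ℕ) _ => (n : ZMod d))
  · intro n hn
    simp only [Finset.mem_filter, Finset.mem_univ, true_and, Finset.mem_range] at hn ⊢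
    have := (ZMod.natCast_eq_zero_iff (n * (n + h)) d).2 hn.2
    exact_mod_cast this
  · intro a ha b hb hab
    simp only [Finset.mem_filter, Finset.mem_range] at ha hb
    rw [ZMod.natCast_eq_natCast_iff'] at hab
    rwa [Nat.mod_eq_of_lt ha.1, Nat.mod_eq_of_lt hb.1] at hab
  · intro x hx
    simp only [Finset.mem_filter, Finset.mem_univ, true_and] at hx
    refine ⟨x.val, ?_, by simp⟩
    simp only [Finset.mem_filter, Finset.mem_range]
    refine ⟨ZMod.val_lt x, ?_⟩
    rw [← ZMod.natCast_eq_zero_iff]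
    push_cast
    simpa using hx

lemma root_periodic (h d : ℕ) : Function.Periodic (fun n => d ∣ n * (n + h)) d := by
  intro n
  simp only [eq_iff_iff]
  have : (n + d) * (n + d + h) = n * (n + h) + d * (2 * n + d + h) := by ring
  rw [this]
  exact (Nat.dvd_add_iff_left (dvd_mul_right _ _)).symm

lemma root_count_mult (h d q : ℕ) (hd : d ≠ 0) :
    ((Finset.Ico 1 (1 + q * d)).filter (fun n => d ∣ n * (n + h))).card = q * rootN h d := by
  induction q with
  | zero => simp
  | succ q ih =>
    have e : Finset.Ico 1 (1 + (q + 1) * d) = Finset.Ico 1 (1 + q * d) ∪ Finset.Ico (1 + q * d) (1 + q * d + d) := by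
      rw [Finset.Ico_union_Ico_eq_Ico (by omega) (by omega)]
      congr 1; ring
    rw [e, Finset.filter_union, Finset.card_union_of_disjoint, ih,
      Nat.filter_Ico_card_eq_of_periodic _ _ _ (root_periodic h d), rootN_count h d hd]
    · ring
    · apply Finset.disjoint_filter_filter
      exact Finset.Ico_disjoint_Ico_consecutive _ _ _

lemma rootN_le (h d : ℕ) (hd : d ≠ 0) : rootN h d ≤ d := by
  rw [← rootN_count h d hd]
  exact Nat.count_le _

lemma root_rem (h d X : ℕ) (hd : d ≠ 0) :
    |(((Finset.Icc 1 X).filter (fun n => d ∣ n * (n + h))).card : ℝ) - rootN h d / d * X| ≤ d := by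
  have hlow : ((Finset.Ico 1 (1 + (X / d) * d)).filter (fun n => d ∣ n * (n + h))).card ≤
      ((Finset.Icc 1 X).filter (fun n => d ∣ n * (n + h))).card := by
    apply Finset.card_le_card
    apply Finset.filter_subset_filter
    intro n hn
    simp only [Finset.mem_Ico, Finset.mem_Icc] at *
    have := Nat.div_mul_le_self X d
    omega
  have hup : ((Finset.Icc 1 X).filter (fun n => d ∣ n * (n + h))).card ≤
     ((Finset.Ico 1 (1 + (X / d + 1) * d)).filter (fun n => d ∣ n * (n + h))).card := by
    apply Finset.card_le_card
    apply Finset.filter_subset_filter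
    intro n hn
    simp only [Finset.mem_Ico, Finset.mem_Icc] at *
    have := Nat.lt_div_mul_add (a := X) (Nat.pos_of_ne_zero hd)
    have h2 : (X / d + 1) * d = X / d * d + d := by ring
    omega
  rw [root_count_mult h d _ hd] at hlow hup
  have hN := rootN_le h d hd
  have hd' : (0 : ℝ) < d := by exact_mod_cast Nat.pos_of_ne_zero hd
  have h1 : ((X / d : ℕ) : ℝ) ≤ X / d := Nat.cast_div_le
  have h2 : (X : ℝ) / d ≤ (X / d : ℕ) + 1 := by
    rw [div_le_iff₀ hd']
    have := Nat.lt_div_mul_add (a := X) (Nat.pos_of_ne_zero hd)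
    have h2 : (X / d + 1) * d = X / d * d + d := by ring
    have : X ≤ (X / d + 1) * d := by omega
    exact_mod_cast this
  have hlow' : ((X / d : ℕ) : ℝ) * rootN h d ≤ ((Finset.Icc 1 X).filter (fun n => d ∣ n * (n + h))).card := by exact_mod_cast hlow
  have hup' : (((Finset.Icc 1 X).filter (fun n => d ∣ n * (n + h))).card : ℝ) ≤ ((X / d : ℕ) + 1) * rootN h d := by exact_mod_cast hup
  have hN' : (rootN h d : ℝ) ≤ d := by exact_mod_cast hN
  have hN0 : (0 : ℝ) ≤ rootN h d := by positivity
  have e : (rootN h d : ℝ) / d * X = rootN h d * (X / d) := by ring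
  rw [e, abs_le]
  constructor <;> nlinarith

/-- product of odd primes up to z -/
def oddP (z : ℕ) : ℕ := ∏ p ∈ (Finset.range (z + 1)).filter (fun p => p.Prime ∧ p ≠ 2), p

lemma oddP_sqf (z : ℕ) : Squarefree (oddP z) := by
  unfold oddP
  refine Finset.squarefree_prod_of_pairwise_isCoprime (fun p hp q hq hpq ↦ ?_) ?_
  · simp only [Finset.coe_filter, Set.mem_ofPred_eq] at hp hq
    exact Nat.coprime_iff_isRelPrime.1 ((Nat.coprime_primes hp.2.1 hq.2.1).2 hpq)
  · intro p hp
    simp only [Finset.mem_filter] at hp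
    exact hp.2.1.prime.squarefree

lemma prime_dvd_oddP (z p : ℕ) (hp : p.Prime) : p ∣ oddP z ↔ p ≤ z ∧ p ≠ 2 := by
  unfold oddP
  rw [hp.prime.dvd_finsetProd_iff]
  constructor
  · rintro ⟨q, hq, hd⟩
    simp only [Finset.mem_filter, Finset.mem_range] at hq
    rw [Nat.prime_dvd_prime_iff_eq hp hq.2.1] at hd
    subst hd
    exact ⟨by omega, hq.2.2⟩
  · rintro ⟨h1, h2⟩
    exact ⟨p, by simp [hp, h2]; omega, dvd_rfl⟩

lemma dvd_oddP (z l : ℕ) (hl : Squarefree l) (hodd : ¬ 2 ∣ l) (hlz : l ≤ z) : l ∣ oddP z := by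
  rw [← Nat.prod_primeFactors_of_squarefree hl]
  unfold oddP
  apply Finset.prod_dvd_prod_of_subset
  intro p hp
  have hp' := Nat.prime_of_mem_primeFactors hp
  have hd := Nat.dvd_of_mem_primeFactors hp
  have := Nat.le_of_dvd (Nat.pos_of_ne_zero hl.ne_zero) hd
  simp only [Finset.mem_filter, Finset.mem_range]
  refine ⟨by omega, hp', ?_⟩
  rintro rfl
  exact hodd hd

/-- local density -/
noncomputable def nuH (h : ℕ) : ArithmeticFunction ℝ :=
  ArithmeticFunction.prodPrimeFactors (fun p => (if p ∣ h then 1 else 2 : ℝ) / p)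

lemma nuH_sqf (h d : ℕ) (hd : Squarefree d) : nuH h d = rhoF h d / d := by
  unfold nuH rhoF
  rw [ArithmeticFunction.prodPrimeFactors_apply hd.ne_zero, Finset.prod_div_distrib]
  push_cast
  congr 1
  · conv_rhs => rw [← Nat.prod_primeFactors_of_squarefree hd]
    push_cast; rfl

lemma nuH_prime (h p : ℕ) (hp : p.Prime) : nuH h p = (if p ∣ h then 1 else 2 : ℝ) / p := by
  unfold nuH
  rw [ArithmeticFunction.prodPrimeFactors_apply hp.ne_zero, hp.primeFactors]
  simp

lemma pair_inj (h X : ℕ) : Set.InjOn (fun n => n * (n + h)) (Finset.Icc 1 X : Finset ℕ) := by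
  intro a ha b hb hab
  simp only [Finset.coe_Icc, Set.mem_Icc] at ha hb hab
  rcases lt_trichotomy a b with h1 | h1 | h1
  · nlinarith
  · exact h1
  · nlinarith

/-- The sieve. -/
noncomputable def mySieve (h X z : ℕ) : BoundingSieve where
  support := (Finset.Icc 1 X).image (fun n => n * (n + h))
  prodPrimes := oddP z
  prodPrimes_squarefree := oddP_sqf z
  weights := fun _ => 1
  weights_nonneg := fun _ => zero_le_one
  totalMass := X
  nu := nuH h
  nu_mult := ArithmeticFunction.IsMultiplicative.prodPrimeFactors _
  nu_pos_of_prime := by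
    intro p hp _
    rw [nuH_prime h p hp]
    have : (0 : ℝ) < p := by exact_mod_cast hp.pos
    split_ifs <;> positivity
  nu_lt_one_of_prime := by
    intro p hp hd
    rw [nuH_prime h p hp]
    have h2 := ((prime_dvd_oddP z p hp).1 hd).2
    have := hp.two_le
    have h3 : 3 ≤ p := by omega
    have : (3 : ℝ) ≤ p := by exact_mod_cast h3
    rw [div_lt_one (by linarith)]
    split_ifs <;> linarith

lemma rhoF_pos (h d : ℕ) : 1 ≤ rhoF h d := by
  unfold rhoF
  apply Nat.one_le_iff_ne_zero.2
  rw [Finset.prod_ne_zero_iff]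
  intros; split_ifs <;> norm_num

lemma sieve_count (h X z : ℕ) (hz : 1 ≤ z) :
    (((Finset.Icc 1 X).filter (fun p => p.Prime ∧ (p + h).Prime)).card : ℝ) ≤
      X / selS (mySieve h X z) z + (z : ℝ) ^ 8 + z := by
  have hb := selberg_bound (mySieve h X z) z hz ?_ ?_
  · have h1 : (((Finset.Icc 1 X).filter (fun p => (oddP z).Coprime (p * (p + h)))).card : ℝ) =
        (mySieve h X z).siftedSum := by
      change _ = ∑ d ∈ (Finset.Icc 1 X).image (fun n => n * (n + h)),
        if (oddP z).Coprime d then (1 : ℝ) else 0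
      rw [Finset.sum_image (pair_inj h X)]
      rw [← Finset.sum_filter]
      simp
    have h2 : ((Finset.Icc 1 X).filter (fun p => p.Prime ∧ (p + h).Prime)).card ≤
        ((Finset.Icc 1 X).filter (fun p => (oddP z).Coprime (p * (p + h)))).card + z := by
      have : ((Finset.Icc 1 X).filter (fun p => p.Prime ∧ (p + h).Prime)) ⊆
        ((Finset.Icc 1 X).filter (fun p => (oddP z).Coprime (p * (p + h)))) ∪ Finset.Icc 1 z := by
        intro p hp
        simp only [Finset.mem_filter, Finset.mem_union, Finset.mem_Icc] at hp ⊢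
        by_cases hpz : p ≤ z
        · right; exact ⟨hp.1.1, hpz⟩
        · left
          refine ⟨hp.1, ?_⟩
          apply Nat.Coprime.mul_right
          · rw [Nat.coprime_comm, hp.2.1.coprime_iff_not_dvd, prime_dvd_oddP z p hp.2.1]
            omega
          · rw [Nat.coprime_comm, hp.2.2.coprime_iff_not_dvd, prime_dvd_oddP z _ hp.2.2]
            omega
      calc _ ≤ _ := Finset.card_le_card this
        _ ≤ _ := Finset.card_union_le _ _
        _ = _ := by simp
    have h3 : (((Finset.Icc 1 X).filter (fun p => p.Prime ∧ (p + h).Prime)).card : ℝ) ≤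
        (((Finset.Icc 1 X).filter (fun p => (oddP z).Coprime (p * (p + h)))).card : ℝ) + z := by
      exact_mod_cast h2
    rw [h1] at h3
    have : (mySieve h X z).totalMass = X := rfl
    rw [this] at hb
    linarith
  · intro d hd
    have hsq : Squarefree d := (oddP_sqf z).squarefree_of_dvd hd
    change (nuH h d)⁻¹ ≤ d
    rw [nuH_sqf h d hsq, inv_div]
    apply div_le_self (by positivity)
    exact_mod_cast rhoF_pos h d
  · intro d hd
    have hsq : Squarefree d := (oddP_sqf z).squarefree_of_dvd hd
    have := root_rem h d X hsq.ne_zero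
    rw [rootN_eq h d hsq, ← nuH_sqf h d hsq] at this
    convert this using 2
    unfold BoundingSieve.rem BoundingSieve.multSum
    simp only [mySieve]
    rw [Finset.sum_image (pair_inj h X), ← Finset.sum_filter]
    simp
lemma sum_cover {α β : Type*} [DecidableEq α] [Nonempty β] (s : Finset α) (t : Finset β) (ψ : β → α) (f : α → ℝ)
    (hf : ∀ a, 0 ≤ f a) (hs : ∀ a ∈ s, ∃ b ∈ t, ψ b = a) : ∑ a ∈ s, f a ≤ ∑ b ∈ t, f (ψ b) := by
  classical
  choose! c hc using hs
  calc ∑ a ∈ s, f a = ∑ a ∈ s, f (ψ (c a)) := Finset.sum_congr rfl fun a ha => by rw [(hc a ha).2]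
    _ = ∑ b ∈ s.image c, f (ψ b) := by
        rw [Finset.sum_image]
        intro a ha b hb hab
        rw [← (hc a ha).2, ← (hc b hb).2, hab]
    _ ≤ _ := by
        apply Finset.sum_le_sum_of_subset_of_nonneg
        · intro b hb
          rw [Finset.mem_image] at hb
          obtain ⟨a, ha, rfl⟩ := hb
          exact (hc a ha).1
        · intros; exact hf _

lemma sum_inv_sq_le (n : ℕ) : ∑ m ∈ Finset.Icc 1 n, (1 : ℝ) / (m : ℝ) ^ 2 ≤ 2 := by
  have : ∀ n : ℕ, ∑ m ∈ Finset.Icc 1 (n + 1), (1 : ℝ) / (m : ℝ) ^ 2 ≤ 2 - 1 / (n + 1) := by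
    intro n
    induction n with
    | zero => norm_num
    | succ n ih =>
      rw [Finset.sum_Icc_succ_top (by omega)]
      push_cast
      have : (1 : ℝ) / ((n : ℝ) + 1 + 1) ^ 2 ≤ 1 / (n + 1) - 1 / (n + 1 + 1) := by
        rw [div_sub_div _ _ (by positivity) (by positivity), div_le_div_iff₀ (by positivity) (by positivity)]
        nlinarith
      linarith
  rcases n with _ | n
  · simp
  refine (this n).trans ?_
  have : (0 : ℝ) ≤ 1 / (n + 1) := by positivity
  linarith

/-- odd squarefree numbers up to y -/
def oddS (y : ℕ) : Finset ℕ := (Finset.Icc 1 y).filter (fun a => Squarefree a ∧ ¬ 2 ∣ a)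

lemma log_le_oddS (y : ℕ) : log (y + 1) ≤ 3 * ∑ a ∈ oddS y, (1 : ℝ) / a := by
  have h1 : log (y + 1) ≤ ∑ n ∈ Finset.Icc 1 y, (1 : ℝ) / n := by
    have := log_add_one_le_harmonic y
    rw [harmonic_eq_sum_Icc] at this
    push_cast at this
    simpa using this
  have h2 : ∑ n ∈ Finset.Icc 1 y, (1 : ℝ) / n ≤
      ∑ q ∈ (Finset.Icc 1 y) ×ˢ ((Finset.Icc 1 2) ×ˢ (oddS y)), (1 : ℝ) / ((q.1 ^ 2 * (q.2.1 * q.2.2) : ℕ) : ℝ) := by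
    apply sum_cover (Finset.Icc 1 y) _ (fun q : ℕ × (ℕ × ℕ) => q.1 ^ 2 * (q.2.1 * q.2.2)) (fun n => (1 : ℝ) / (n : ℝ))
    · intro a; positivity
    · intro n hn
      simp only [Finset.mem_Icc] at hn
      obtain ⟨a, b, ha, hb, hab, hsq⟩ := Nat.sq_mul_squarefree_of_pos (n := n) (by omega)
      have hale : a ≤ n := Nat.le_of_dvd (by omega) ⟨b ^ 2, by rw [← hab]; ring⟩
      have hble : b ≤ n := Nat.le_of_dvd (by omega) ⟨b * a, by rw [← hab]; ring⟩
      by_cases h2 : 2 ∣ a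
      · obtain ⟨c, rfl⟩ := h2
        have hc : ¬ 2 ∣ c := by
          rintro ⟨e, rfl⟩
          have := hsq 2 ⟨e, by ring⟩
          simp at this
        refine ⟨(b, 2, c), ?_, hab⟩
        simp only [Finset.mem_product, Finset.mem_Icc, oddS, Finset.mem_filter]
        refine ⟨⟨by omega, by omega⟩, ⟨by omega, by omega⟩, ⟨by omega, by omega⟩, hsq.of_mul_right, hc⟩
      · refine ⟨(b, 1, a), ?_, by simpa using hab⟩
        simp only [Finset.mem_product, Finset.mem_Icc, oddS, Finset.mem_filter]
        exact ⟨⟨by omega, by omega⟩, ⟨by omega, by omega⟩, ⟨by omega, by omega⟩, hsq, h2⟩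
  have h3 : ∑ q ∈ (Finset.Icc 1 y) ×ˢ ((Finset.Icc 1 2) ×ˢ (oddS y)), (1 : ℝ) / ((q.1 ^ 2 * (q.2.1 * q.2.2) : ℕ) : ℝ)
      = (∑ m ∈ Finset.Icc 1 y, (1 : ℝ) / (m : ℝ) ^ 2) * ((∑ c ∈ Finset.Icc 1 2, (1 : ℝ) / ((c : ℕ) : ℝ)) * ∑ a ∈ oddS y, (1 : ℝ) / a) := by
    rw [Finset.sum_mul_sum, ← Finset.sum_product', Finset.sum_mul_sum, ← Finset.sum_product']
    apply Finset.sum_congr rfl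
    intro q _
    push_cast
    simp only [one_div, mul_inv]
  have h4 : (∑ c ∈ Finset.Icc 1 2, (1 : ℝ) / ((c : ℕ) : ℝ)) = 3 / 2 := by
    rw [show Finset.Icc 1 2 = ({1, 2} : Finset ℕ) by decide]
    norm_num
  have h5 : 0 ≤ ∑ a ∈ oddS y, (1 : ℝ) / a := Finset.sum_nonneg fun _ _ => by positivity
  have h6 := sum_inv_sq_le y
  rw [h3, h4] at h2
  nlinarith

/-- sum of reciprocals of squarefree divisors -/
noncomputable def Tsf (h : ℕ) : ℝ := ∑ e ∈ h.divisors.filter Squarefree, (1 : ℝ) / e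

lemma card_cop_le (h l : ℕ) (hl : Squarefree l) :
    (l.divisors.filter (fun b => b.Coprime h)).card ≤ rhoF h l := by
  have key := (ArithmeticFunction.IsMultiplicative.prodPrimeFactors (R := ℕ)
    (fun p => if p ∣ h then 0 else 1)).prodPrimeFactors_one_add_of_squarefree hl
  have e : rhoF h l = ∏ p ∈ l.primeFactors, (1 + (ArithmeticFunction.prodPrimeFactors (R := ℕ)
    (fun p => if p ∣ h then 0 else 1)) p) := by
    unfold rhoF
    apply Finset.prod_congr rfl
    intro p hp
    have hp' := Nat.prime_of_mem_primeFactors hp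
    rw [ArithmeticFunction.prodPrimeFactors_apply hp'.ne_zero, hp'.primeFactors]
    simp only [Finset.prod_singleton]
    split_ifs <;> rfl
  rw [e, key, Finset.card_eq_sum_ones, Finset.sum_filter]
  apply Finset.sum_le_sum
  intro d hd
  split_ifs with hc
  · rw [ArithmeticFunction.prodPrimeFactors_apply (Nat.pos_of_mem_divisors hd).ne']
    rw [Finset.prod_congr rfl (g := fun _ => 1)]
    · simp
    · intro p hp
      rw [if_neg]
      intro hph
      have hp' := Nat.prime_of_mem_primeFactors hp
      have := Nat.dvd_gcd (Nat.dvd_of_mem_primeFactors hp) hph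
      rw [hc] at this
      exact hp'.one_lt.ne' (Nat.dvd_one.1 this)
  · exact Nat.zero_le _

lemma oddS_sq_le (h y : ℕ) (hh : h ≠ 0) : (∑ a ∈ oddS y, (1 : ℝ) / a) ^ 2 ≤
    2 * Tsf h * ∑ l ∈ oddS (y ^ 2), (rhoF h l : ℝ) / l := by
  classical
  rw [sq, Finset.sum_mul_sum, ← Finset.sum_product']
  have h2 : ∑ q ∈ oddS y ×ˢ oddS y, (1 : ℝ) / (q.1 : ℝ) * (1 / (q.2 : ℝ)) ≤
      ∑ r ∈ (Finset.Icc 1 y ×ˢ (h.divisors.filter Squarefree)) ×ˢ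
        ((oddS (y ^ 2)).sigma (fun l => l.divisors.filter (fun b => b.Coprime h))),
        (1 : ℝ) / ((r.1.1 * (r.2.1 / r.2.2) : ℕ) : ℝ) * (1 / ((r.1.1 * r.1.2 * r.2.2 : ℕ) : ℝ)) := by
    apply sum_cover (oddS y ×ˢ oddS y) _
      (fun r : (ℕ × ℕ) × ((_ : ℕ) × ℕ) => ((r.1.1 * (r.2.1 / r.2.2), r.1.1 * r.1.2 * r.2.2) : ℕ × ℕ))
      (fun q : ℕ × ℕ => (1 : ℝ) / (q.1 : ℝ) * (1 / (q.2 : ℝ)))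
    · intro a; positivity
    · rintro ⟨a, b⟩ hab
      simp only [Finset.mem_product, oddS, Finset.mem_filter, Finset.mem_Icc] at hab
      obtain ⟨⟨⟨ha1, hay⟩, hasq, ha2⟩, ⟨hb1, hby⟩, hbsq, hb2⟩ := hab
      have hg0 : 0 < a.gcd b := Nat.gcd_pos_of_pos_left _ ha1
      obtain ⟨a', ha'⟩ := Nat.gcd_dvd_left a b
      obtain ⟨b', hb'⟩ := Nat.gcd_dvd_right a b
      have hcop : a'.Coprime b' := by
        have := Nat.coprime_div_gcd_div_gcd hg0
        rwa [Nat.div_eq_of_eq_mul_right hg0 ha', Nat.div_eq_of_eq_mul_right hg0 hb'] at this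
      set g := a.gcd b with hg
      clear_value g
      have hb'0 : 0 < b' := by
        rcases Nat.eq_zero_or_pos b' with h0 | h0
        · subst h0; omega
        · exact h0
      have he0 : 0 < b'.gcd h := Nat.gcd_pos_of_pos_left _ hb'0
      obtain ⟨c, hc⟩ := Nat.gcd_dvd_left b' h
      have heh := Nat.gcd_dvd_right b' h
      have hb'sq : Squarefree b' := by rw [hb'] at hbsq; exact hbsq.of_mul_right
      have hcop2 : (b'.gcd h).Coprime c := by
        rw [hc] at hb'sq; exact Nat.coprime_of_squarefree_mul hb'sq
      have hch : c.Coprime h := by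
        have h1 : c.gcd h ∣ b'.gcd h := Nat.dvd_gcd ((Nat.gcd_dvd_left c h).trans ⟨_, by rw [mul_comm]; exact hc⟩) (Nat.gcd_dvd_right c h)
        have h3 : c.gcd h ∣ (b'.gcd h).gcd c := Nat.dvd_gcd h1 (Nat.gcd_dvd_left c h)
        rw [hcop2] at h3
        exact Nat.dvd_one.1 h3
      have hesq : Squarefree (b'.gcd h) := hb'sq.squarefree_of_dvd (Nat.gcd_dvd_left _ _)
      have hcb' : c ∣ b' := ⟨_, by rw [mul_comm]; exact hc⟩
      have hcpos : 0 < c := Nat.pos_of_dvd_of_pos hcb' hb'0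
      have ha'0 : 0 < a' := by
        rcases Nat.eq_zero_or_pos a' with h0 | h0
        · subst h0; omega
        · exact h0
      have ha'a : a' ∣ a := ⟨g, by rw [mul_comm]; exact ha'⟩
      have hcb : c ∣ b := hcb'.trans ⟨g, by rw [mul_comm]; exact hb'⟩
      refine ⟨((g, b'.gcd h), ⟨a' * c, c⟩), ?_, ?_⟩
      · simp only [Finset.mem_product, Finset.mem_filter, Finset.mem_Icc, Finset.mem_sigma, oddS, Nat.mem_divisors]
        refine ⟨⟨⟨hg0, (Nat.le_of_dvd ha1 ⟨a', ha'⟩).trans hay⟩, ⟨heh, hh⟩, hesq⟩, ⟨⟨Nat.mul_pos ha'0 hcpos, ?_⟩, ?_, ?_⟩, ⟨dvd_mul_left _ _, (Nat.mul_pos ha'0 hcpos).ne'⟩, hch⟩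
        · rw [sq]
          exact Nat.mul_le_mul ((Nat.le_of_dvd ha1 ha'a).trans hay) ((Nat.le_of_dvd hb1 hcb).trans hby)
        · rw [Nat.squarefree_mul (hcop.coprime_dvd_right hcb')]
          exact ⟨hasq.squarefree_of_dvd ha'a, hb'sq.squarefree_of_dvd hcb'⟩
        · rw [Nat.prime_two.dvd_mul]
          rintro (h0 | h0)
          · exact ha2 (h0.trans ha'a)
          · exact hb2 (h0.trans hcb)
      · simp only [Prod.mk.injEq]
        rw [Nat.mul_div_cancel _ hcpos]
        exact ⟨ha'.symm, by rw [mul_assoc, ← hc, ← hb']⟩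
  refine h2.trans ?_
  have h3 : ∀ r ∈ (Finset.Icc 1 y ×ˢ (h.divisors.filter Squarefree)) ×ˢ
        ((oddS (y ^ 2)).sigma (fun l => l.divisors.filter (fun b => b.Coprime h))),
        (1 : ℝ) / ((r.1.1 * (r.2.1 / r.2.2) : ℕ) : ℝ) * (1 / ((r.1.1 * r.1.2 * r.2.2 : ℕ) : ℝ)) =
        (1 / (r.1.1 : ℝ) ^ 2 * (1 / (r.1.2 : ℝ))) * (1 / (r.2.1 : ℝ)) := by
    rintro ⟨⟨g, e⟩, ⟨l, b⟩⟩ hr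
    simp only [Finset.mem_product, Finset.mem_filter, Finset.mem_Icc, Finset.mem_sigma, oddS, Nat.mem_divisors] at hr
    obtain ⟨_, ⟨⟨hl, _⟩, _⟩, ⟨⟨c, hc⟩, _⟩, _⟩ := hr
    have hb : 0 < b := by
      rcases Nat.eq_zero_or_pos b with h0 | h0
      · subst h0; omega
      · exact h0
    simp only
    have : l / b = c := Nat.div_eq_of_eq_mul_right hb hc
    rw [this, hc]
    push_cast
    simp only [one_div, mul_inv, ← inv_pow]
    ring
  rw [Finset.sum_congr rfl h3, Finset.sum_product]
  simp only
  rw [← Finset.sum_mul_sum, Finset.sum_product' (f := fun (g e : ℕ) => 1 / (g : ℝ) ^ 2 * (1 / (e : ℝ))), ← Finset.sum_mul_sum, Finset.sum_sigma]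
  change _ * Tsf h * _ ≤ _
  have hT : 0 ≤ Tsf h := Finset.sum_nonneg fun _ _ => by positivity
  have h6 := sum_inv_sq_le y
  have h7 : ∑ l ∈ oddS (y ^ 2), ∑ b ∈ l.divisors.filter (fun b => b.Coprime h), (1 : ℝ) / (l : ℝ) ≤
      ∑ l ∈ oddS (y ^ 2), (rhoF h l : ℝ) / l := by
    apply Finset.sum_le_sum
    intro l hl
    simp only [oddS, Finset.mem_filter] at hl
    rw [Finset.sum_const, nsmul_eq_mul, mul_one_div]
    have := card_cop_le h l hl.2.1
    gcongr
  have h8 : 0 ≤ ∑ l ∈ oddS (y ^ 2), ∑ b ∈ l.divisors.filter (fun b => b.Coprime h), (1 : ℝ) / (l : ℝ) :=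
    Finset.sum_nonneg fun _ _ => Finset.sum_nonneg fun _ _ => by positivity
  exact mul_le_mul (mul_le_mul_of_nonneg_right h6 hT) h7 h8 (by positivity)

lemma selS_ge (h X y : ℕ) : ∑ l ∈ oddS (y ^ 2), (rhoF h l : ℝ) / l ≤ selS (mySieve h X (y ^ 2)) (y ^ 2) := by
  unfold selS
  rw [← Finset.sum_filter]
  have hsub : oddS (y ^ 2) ⊆ (mySieve h X (y ^ 2)).prodPrimes.divisors.filter (· ≤ y ^ 2) := by
    intro l hl
    simp only [oddS, Finset.mem_filter, Finset.mem_Icc] at hl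
    simp only [Finset.mem_filter, Nat.mem_divisors]
    exact ⟨⟨dvd_oddP _ _ hl.2.1 hl.2.2 hl.1.2, BoundingSieve.prodPrimes_ne_zero⟩, hl.1.2⟩
  refine le_trans ?_ (Finset.sum_le_sum_of_subset_of_nonneg hsub ?_)
  · apply Finset.sum_le_sum
    intro l hl
    have hl' := hsub hl
    simp only [Finset.mem_filter, Nat.mem_divisors] at hl'
    have hP := hl'.1.1
    simp only [oddS, Finset.mem_filter, Finset.mem_Icc] at hl
    rw [BoundingSieve.selbergTerms_apply]
    change _ ≤ nuH h l * _
    rw [nuH_sqf h l hl.2.1]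
    apply le_mul_of_one_le_right (by positivity)
    refine Finset.prod_induction _ (fun x : ℝ => 1 ≤ x)
      (fun a b ha hb => one_le_mul_of_one_le_of_one_le ha hb) le_rfl ?_
    intro p hp
    have hp' := Nat.prime_of_mem_primeFactors hp
    have hpP := (Nat.dvd_of_mem_primeFactors hp).trans hP
    have h1 := (mySieve h X (y ^ 2)).nu_lt_one_of_prime p hp' hpP
    have h0 := (mySieve h X (y ^ 2)).nu_pos_of_prime p hp' hpP
    exact (one_le_inv₀ (by linarith)).2 (by linarith)
  · intro l hl _
    simp only [Finset.mem_filter, Nat.mem_divisors] at hl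
    exact (BoundingSieve.selbergTerms_pos hl.1.1).le

lemma sieve_count2 (h X y : ℕ) (hh : h ≠ 0) (hy : 1 ≤ y) :
    (((Finset.Icc 1 X).filter (fun p => p.Prime ∧ (p + h).Prime)).card : ℝ) ≤
      18 * Tsf h * X / (log (y + 1)) ^ 2 + 2 * (y : ℝ) ^ 16 := by
  have h1 := sieve_count h X (y ^ 2) (Nat.one_le_pow _ _ hy)
  have h2 := oddS_sq_le h y hh
  have h3 := selS_ge h X y
  have h4 := log_le_oddS y
  have hT : 0 ≤ Tsf h := Finset.sum_nonneg fun _ _ => by positivity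
  have hy' : (1 : ℝ) ≤ y := by exact_mod_cast hy
  have h5 : 0 < log ((y : ℝ) + 1) := log_pos (by linarith)
  have hS := selS_pos (mySieve h X (y ^ 2)) (y ^ 2) (Nat.one_le_pow _ _ hy)
  set S := selS (mySieve h X (y ^ 2)) (y ^ 2)
  have h6 : log ((y : ℝ) + 1) ^ 2 ≤ 18 * Tsf h * S := by
    calc log ((y : ℝ) + 1) ^ 2 ≤ (3 * ∑ a ∈ oddS y, (1 : ℝ) / a) ^ 2 := by gcongr
      _ = 9 * (∑ a ∈ oddS y, (1 : ℝ) / a) ^ 2 := by ring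
      _ ≤ 9 * (2 * Tsf h * S) := by
        refine mul_le_mul_of_nonneg_left (h2.trans ?_) (by norm_num)
        exact mul_le_mul_of_nonneg_left h3 (by positivity)
      _ = _ := by ring
  have h7 : (X : ℝ) / S ≤ 18 * Tsf h * X / (log (y + 1)) ^ 2 := by
    rw [div_le_div_iff₀ hS (by positivity)]
    have : (0 : ℝ) ≤ X := by positivity
    nlinarith
  have h8 : (y : ℝ) ^ 2 ≤ (y : ℝ) ^ 16 := pow_le_pow_right₀ hy' (by norm_num)
  push_cast at h1
  have h9 : ((y : ℝ) ^ 2) ^ 8 = (y : ℝ) ^ 16 := by ring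
  rw [h9] at h1
  linarith
/-- sum of log p / p -/
noncomputable def mA (n : ℕ) : ℝ := ∑ p ∈ (Finset.Icc 1 n).filter Nat.Prime, log p / p
/-- sum of 1 / p -/
noncomputable def mB (n : ℕ) : ℝ := ∑ p ∈ (Finset.Icc 1 n).filter Nat.Prime, (1 : ℝ) / p

lemma sum_log_primeFactors_le (m : ℕ) (hm : m ≠ 0) : ∑ p ∈ m.primeFactors, log p ≤ log m := by
  rw [← Real.log_prod]
  · apply Real.log_le_log
    · apply Finset.prod_pos
      intro p hp
      exact_mod_cast (Nat.prime_of_mem_primeFactors hp).pos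
    · have := Nat.le_of_dvd (Nat.pos_of_ne_zero hm) (Nat.prod_primeFactors_dvd m)
      rw [← Nat.cast_prod]
      exact Nat.cast_le.2 this
  · intro p hp
    exact_mod_cast (Nat.prime_of_mem_primeFactors hp).ne_zero

lemma mA_le (n : ℕ) (hn : 1 ≤ n) : mA n ≤ log n + log 4 := by
  have hn' : (0 : ℝ) < n := by exact_mod_cast hn
  have h1 : ∑ m ∈ Finset.Ioc 0 n, ∑ p ∈ m.primeFactors, log p ≤ n * log n := by
    calc _ ≤ ∑ m ∈ Finset.Ioc 0 n, log n := by
          apply Finset.sum_le_sum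
          intro m hm
          simp only [Finset.mem_Ioc] at hm
          refine (sum_log_primeFactors_le m (by omega)).trans ?_
          apply Real.log_le_log
          · exact_mod_cast hm.1
          · exact_mod_cast hm.2
      _ = _ := by simp
  have h2 : ∑ m ∈ Finset.Ioc 0 n, ∑ p ∈ m.primeFactors, log p =
      ∑ p ∈ (Finset.Icc 1 n).filter Nat.Prime, ((n / p : ℕ) : ℝ) * log p := by
    have : ∀ m ∈ Finset.Ioc 0 n, ∑ p ∈ m.primeFactors, log p =
        ∑ p ∈ (Finset.Icc 1 n).filter Nat.Prime, if p ∣ m then log p else 0 := by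
      intro m hm
      simp only [Finset.mem_Ioc] at hm
      rw [← Finset.sum_filter]
      apply Finset.sum_congr _ (fun _ _ => rfl)
      ext p
      simp only [Nat.mem_primeFactors, Finset.mem_filter, Finset.mem_Icc]
      constructor
      · rintro ⟨h1, h2, h3⟩
        exact ⟨⟨⟨h1.pos, (Nat.le_of_dvd hm.1 h2).trans hm.2⟩, h1⟩, h2⟩
      · rintro ⟨⟨_, h1⟩, h2⟩
        exact ⟨h1, h2, by omega⟩
    rw [Finset.sum_congr rfl this, Finset.sum_comm]
    apply Finset.sum_congr rfl
    intro p _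
    rw [← Finset.sum_filter, Finset.sum_const, Nat.Ioc_filter_dvd_card_eq_div, nsmul_eq_mul]
  have h3 : n * mA n - Chebyshev.theta n ≤ ∑ p ∈ (Finset.Icc 1 n).filter Nat.Prime, ((n / p : ℕ) : ℝ) * log p := by
    have : Chebyshev.theta n = ∑ p ∈ (Finset.Icc 1 n).filter Nat.Prime, log p := by
      unfold Chebyshev.theta
      rw [Nat.floor_natCast]
      rfl
    rw [this]
    unfold mA
    rw [Finset.mul_sum, ← Finset.sum_sub_distrib]
    apply Finset.sum_le_sum
    intro p hp
    simp only [Finset.mem_filter] at hp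
    have hp0 : (0 : ℝ) < p := by exact_mod_cast hp.2.pos
    have hl : 0 ≤ log p := log_nonneg (by exact_mod_cast hp.2.one_le)
    have : (n : ℝ) / p ≤ (n / p : ℕ) + 1 := by
      rw [div_le_iff₀ hp0]
      have := Nat.lt_div_mul_add (a := n) hp.2.pos
      have h2 : (n / p + 1) * p = n / p * p + p := by ring
      have : n ≤ (n / p + 1) * p := by omega
      exact_mod_cast this
    have e : (n : ℝ) * (log p / p) = n / p * log p := by ring
    rw [e]
    nlinarith
  have h4 := Chebyshev.theta_le_log4_mul_x (x := n) hn'.le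
  have h5 : n * mA n ≤ n * (log n + log 4) := by
    rw [← h2] at h3
    linarith
  exact le_of_mul_le_mul_left h5 hn'

lemma mA_succ (n : ℕ) : mA (n + 1) = mA n + if (n + 1).Prime then log (n + 1 : ℕ) / (n + 1 : ℕ) else 0 := by
  unfold mA
  rw [Finset.sum_filter, Finset.sum_filter, Finset.sum_Icc_succ_top (by omega)]

lemma mB_succ (n : ℕ) : mB (n + 1) = mB n + if (n + 1).Prime then 1 / ((n + 1 : ℕ) : ℝ) else 0 := by
  unfold mB
  rw [Finset.sum_filter, Finset.sum_filter, Finset.sum_Icc_succ_top (by omega)]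

lemma mB_aux (n : ℕ) : mB (n + 2) - mA (n + 2) / log (n + 2 : ℕ) - log (log (n + 2 : ℕ)) + log 4 / log (n + 2 : ℕ)
    ≤ 2 - log (log 2) := by
  induction n with
  | zero =>
    have : (Finset.Icc 1 2).filter Nat.Prime = {2} := by decide
    have h0 : 0 < log 2 := log_pos (by norm_num)
    have h4 : log 4 = 2 * log 2 := by
      rw [show (4 : ℝ) = 2 ^ 2 by norm_num, log_pow]; norm_num
    unfold mB mA
    rw [zero_add, this]
    simp only [Finset.sum_singleton]
    push_cast
    rw [h4]
    field_simp
    linarith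
  | succ n ih =>
    refine le_trans ?_ ih
    have hu : 0 < log (n + 2 : ℕ) := log_pos (by push_cast; linarith [(Nat.cast_nonneg n : (0 : ℝ) ≤ n)])
    have huv : log (n + 2 : ℕ) ≤ log (n + 2 + 1 : ℕ) := Real.log_le_log (by positivity) (by push_cast; linarith)
    have hv : 0 < log (n + 2 + 1 : ℕ) := hu.trans_le huv
    have hA := mA_le (n + 2) (by omega)
    rw [show n + 1 + 2 = n + 2 + 1 by ring, mB_succ, mA_succ]
    set u := log (n + 2 : ℕ)
    set v := log (n + 2 + 1 : ℕ)
    have hD : (if (n + 2 + 1).Prime then 1 / ((n + 2 + 1 : ℕ) : ℝ) else 0) =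
      (if (n + 2 + 1).Prime then v / ((n + 2 + 1 : ℕ) : ℝ) else 0) / v := by
      split_ifs
      · field_simp
      · simp
    rw [hD]
    set a := (if (n + 2 + 1).Prime then v / ((n + 2 + 1 : ℕ) : ℝ) else 0)
    have h1 : log u - log v ≤ u / v - 1 := by
      rw [← Real.log_div hu.ne' hv.ne']
      exact Real.log_le_sub_one_of_pos (by positivity)
    have h2 : mA (n + 2) * (1 / u - 1 / v) ≤ (u + log 4) * (1 / u - 1 / v) := by
      apply mul_le_mul_of_nonneg_right hA
      rw [sub_nonneg]
      exact one_div_le_one_div_of_le hu huv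
    have h3 : (u + log 4) * (1 / u - 1 / v) = 1 - u / v + log 4 / u - log 4 / v := by
      field_simp
      ring
    have h4 : mA (n + 2) * (1 / u - 1 / v) = mA (n + 2) / u - mA (n + 2) / v := by ring
    rw [add_div]
    linarith

lemma mB_le (n : ℕ) (hn : 2 ≤ n) : mB n ≤ log (log n) + (3 - log (log 2)) := by
  obtain ⟨m, rfl⟩ : ∃ m, n = m + 2 := ⟨n - 2, by omega⟩
  have h1 := mB_aux m
  have h2 := mA_le (m + 2) (by omega)
  have hu : 0 < log (m + 2 : ℕ) := log_pos (by push_cast; linarith [(Nat.cast_nonneg m : (0 : ℝ) ≤ m)])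
  have h3 : mA (m + 2) / log (m + 2 : ℕ) ≤ 1 + log 4 / log (m + 2 : ℕ) := by
    calc _ ≤ (log (m + 2 : ℕ) + log 4) / log (m + 2 : ℕ) := by gcongr
      _ = _ := by rw [add_div, div_self hu.ne']
  linarith

lemma Tsf_le_exp (h : ℕ) (hh : h ≠ 0) : Tsf h ≤ exp (∑ p ∈ h.primeFactors, (1 : ℝ) / p) := by
  unfold Tsf
  calc _ ≤ ∑ t ∈ h.primeFactors.powerset, (1 : ℝ) / ((∏ p ∈ t, p : ℕ) : ℝ) := by
        apply sum_cover _ _ (fun t : Finset ℕ => ∏ p ∈ t, p) (fun e : ℕ => (1 : ℝ) / (e : ℝ))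
        · intro a; positivity
        · intro e he
          simp only [Finset.mem_filter, Nat.mem_divisors] at he
          refine ⟨e.primeFactors, ?_, Nat.prod_primeFactors_of_squarefree he.2⟩
          rw [Finset.mem_powerset]
          exact Nat.primeFactors_mono he.1.1 hh
    _ = ∏ p ∈ h.primeFactors, (1 + (1 : ℝ) / p) := by
        rw [Finset.prod_one_add]
        apply Finset.sum_congr rfl
        intro t _
        push_cast
        simp only [one_div, Finset.prod_inv_distrib]
    _ ≤ ∏ p ∈ h.primeFactors, exp ((1 : ℝ) / p) := by
        apply Finset.prod_le_prod
        · intros; positivity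
        · intro p _
          rw [add_comm]; exact Real.add_one_le_exp _
    _ = _ := (Real.exp_sum _ _).symm

lemma omega_le (h : ℕ) (hh : h ≠ 0) : (h.primeFactors.card : ℝ) * log 2 ≤ log h := by
  refine le_trans ?_ (sum_log_primeFactors_le h hh)
  rw [← nsmul_eq_mul]
  apply Finset.card_nsmul_le_sum
  intro p hp
  apply Real.log_le_log (by norm_num)
  exact_mod_cast (Nat.prime_of_mem_primeFactors hp).two_le

lemma Tsf_le : ∃ C : ℝ, 0 < C ∧ ∀ N : ℕ, 8 ≤ N → ∀ h : ℕ, h ≠ 0 → h ≤ N → Tsf h ≤ C * log (log N) := by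
  refine ⟨exp (3 - log (log 2) + 1 / log 2), exp_pos _, ?_⟩
  intro N hN h hh hhN
  have hl2 : 0 < log 2 := log_pos (by norm_num)
  have hlN : 2 ≤ log (N : ℝ) := by
    have h8 : log (8 : ℝ) ≤ log N := Real.log_le_log (by norm_num) (by exact_mod_cast hN)
    have : log (8 : ℝ) = 3 * log 2 := by
      rw [show (8 : ℝ) = 2 ^ 3 by norm_num, log_pow]; norm_num
    have := Real.log_two_gt_d9
    linarith
  set L := ⌊log (N : ℝ)⌋₊ with hL
  have hL2 : 2 ≤ L := Nat.le_floor (by exact_mod_cast hlN)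
  have hLle : (L : ℝ) ≤ log N := Nat.floor_le (by linarith)
  have hLlt : log (N : ℝ) < L + 1 := Nat.lt_floor_add_one _
  have h1 : ∑ p ∈ h.primeFactors, (1 : ℝ) / p ≤ mB L + 1 / log 2 := by
    rw [← Finset.sum_filter_add_sum_filter_not _ (fun p => p ≤ L)]
    apply add_le_add
    · unfold mB
      apply Finset.sum_le_sum_of_subset_of_nonneg
      · intro p hp
        simp only [Finset.mem_filter, Nat.mem_primeFactors, Finset.mem_Icc] at hp ⊢
        exact ⟨⟨hp.1.1.pos, hp.2⟩, hp.1.1⟩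
      · intros; positivity
    · calc _ ≤ ∑ p ∈ h.primeFactors.filter (fun p => ¬ p ≤ L), 1 / log (N : ℝ) := by
            apply Finset.sum_le_sum
            intro p hp
            simp only [Finset.mem_filter, not_le] at hp
            apply one_div_le_one_div_of_le (by linarith)
            have : (L : ℝ) + 1 ≤ p := by exact_mod_cast hp.2
            linarith
        _ ≤ ∑ p ∈ h.primeFactors, 1 / log (N : ℝ) := by
            apply Finset.sum_le_sum_of_subset_of_nonneg (Finset.filter_subset _ _)
            intros; positivity
        _ = h.primeFactors.card / log (N : ℝ) := by
            rw [Finset.sum_const, nsmul_eq_mul, mul_one_div]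
        _ ≤ 1 / log 2 := by
            rw [div_le_div_iff₀ (by linarith) hl2, one_mul]
            refine (omega_le h hh).trans (Real.log_le_log (by exact_mod_cast Nat.pos_of_ne_zero hh) (by exact_mod_cast hhN))
  have h2 := mB_le L hL2
  have hlL : 0 < log (L : ℝ) := log_pos (by exact_mod_cast hL2)
  have hloglog : 0 < log (log (N : ℝ)) := log_pos (by linarith)
  have h3 : log (log (L : ℝ)) ≤ log (log (log (N : ℝ))) := by
    apply Real.log_le_log hlL
    apply Real.log_le_log (by positivity) hLle
  calc Tsf h ≤ exp (∑ p ∈ h.primeFactors, (1 : ℝ) / p) := Tsf_le_exp h hh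
    _ ≤ exp ((3 - log (log 2) + 1 / log 2) + log (log (log (N : ℝ)))) := by
        apply Real.exp_le_exp.2; linarith
    _ = _ := by rw [Real.exp_add, Real.exp_log hloglog]
lemma loglog_ge_one (N : ℕ) (hN : 16 ≤ N) : 1 ≤ log (log N) := by
  have h1 : (2.718281829 : ℝ) ≤ log N := by
    have : log (16 : ℝ) ≤ log N := Real.log_le_log (by norm_num) (by exact_mod_cast hN)
    have h2 : log (16 : ℝ) = 4 * log 2 := by
      rw [show (16 : ℝ) = 2 ^ 4 by norm_num, Real.log_pow]; norm_num
    have := Real.log_two_gt_d9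
    linarith
  rw [Real.le_log_iff_exp_le (by linarith)]
  have := Real.exp_one_lt_d9
  linarith

/-- primes p up to X with p+h prime -/
noncomputable def piH (h X : ℕ) : ℝ :=
  (((Finset.Icc 1 X).filter (fun p => p.Prime ∧ (p + h).Prime)).card : ℝ)

lemma piH_le (h X : ℕ) : piH h X ≤ X := by
  unfold piH
  have := Finset.card_filter_le (Finset.Icc 1 X) (fun p => p.Prime ∧ (p + h).Prime)
  simp only [Nat.card_Icc, Nat.add_sub_cancel] at this
  exact_mod_cast this

lemma piH_bound : ∃ C : ℝ, 0 < C ∧ ∀ N : ℕ, 16 ≤ N → ∀ h : ℕ, h ≠ 0 → h ≤ N → ∀ X : ℕ,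
    √(N : ℝ) ≤ X → X ≤ N → piH h X ≤ C * X * log (log N) / (log N) ^ 2 := by
  obtain ⟨C, hC, hT⟩ := Tsf_le
  refine ⟨73728 * C + 128, by positivity, ?_⟩
  intro N hN h hh hhN X hX hXN
  have hll := loglog_ge_one N hN
  have hNr : (16 : ℝ) ≤ N := by exact_mod_cast hN
  have hN0 : (0 : ℝ) < N := by linarith
  have hsq : 0 < √(N : ℝ) := Real.sqrt_pos.2 hN0
  have hX0 : (0 : ℝ) < X := by linarith
  have hX1 : (1 : ℝ) ≤ X := by
    have : 0 < X := by exact_mod_cast hX0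
    exact_mod_cast this
  have hlN : 0 < log N := Real.log_pos (by linarith)
  have hlX : log N / 2 ≤ log X := by
    rw [← Real.log_sqrt hN0.le]
    exact Real.log_le_log hsq hX
  set z : ℝ := (X : ℝ) ^ (1 / 32 : ℝ) with hz
  have hz1 : 1 ≤ z := Real.one_le_rpow hX1 (by norm_num)
  set y := ⌊z⌋₊ with hy
  have hy1 : 1 ≤ y := Nat.le_floor (by simpa using hz1)
  have hyz : (y : ℝ) ≤ z := Nat.floor_le (by linarith)
  have hzy : z ≤ (y : ℝ) + 1 := (Nat.lt_floor_add_one z).le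
  have h1 := sieve_count2 h X y hh hy1
  have h2 : log N / 64 ≤ log (y + 1) := by
    have : log z ≤ log (y + 1) := Real.log_le_log (by linarith) hzy
    rw [hz, Real.log_rpow hX0] at this
    linarith
  have h3 : (y : ℝ) ^ 16 ≤ √(X : ℝ) := by
    calc (y : ℝ) ^ 16 ≤ z ^ 16 := by gcongr
      _ = √(X : ℝ) := by
        rw [hz, ← Real.rpow_natCast, ← Real.rpow_mul hX0.le, Real.sqrt_eq_rpow]; norm_num
  have h4 : (log N) ^ 2 ≤ 64 * √(X : ℝ) := by
    have h5 : log N ≤ (N : ℝ) ^ (1 / 8 : ℝ) / (1 / 8) := Real.log_le_rpow_div hN0.le (by norm_num)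
    calc (log N) ^ 2 ≤ ((N : ℝ) ^ (1 / 8 : ℝ) / (1 / 8)) ^ 2 := by gcongr
      _ = 64 * √(√(N : ℝ)) := by
        rw [div_pow, ← Real.rpow_natCast, ← Real.rpow_mul hN0.le, Real.sqrt_eq_rpow,
          Real.sqrt_eq_rpow, ← Real.rpow_mul hN0.le]
        norm_num
        ring
      _ ≤ _ := by gcongr
  have hTh := hT N (by omega) h hh hhN
  have h5 : 18 * Tsf h * X / (log (y + 1)) ^ 2 ≤ 73728 * C * X * log (log N) / (log N) ^ 2 := by
    calc 18 * Tsf h * X / (log (y + 1)) ^ 2 ≤ 18 * (C * log (log N)) * X / (log N / 64) ^ 2 := by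
          gcongr
      _ = _ := by field_simp; ring
  have h6 : 2 * (y : ℝ) ^ 16 ≤ 128 * X * log (log N) / (log N) ^ 2 := by
    rw [le_div_iff₀ (by positivity)]
    calc 2 * (y : ℝ) ^ 16 * (log N) ^ 2 ≤ 2 * √(X : ℝ) * (64 * √(X : ℝ)) := by gcongr
      _ = 128 * X * 1 := by
        have := Real.mul_self_sqrt hX0.le
        linear_combination 128 * this
      _ ≤ _ := by gcongr
  unfold piH
  refine h1.trans ((add_le_add h5 h6).trans (le_of_eq ?_))
  ring

lemma sum_logdiv : ∃ C : ℝ, 0 < C ∧ ∀ N : ℕ, 16 ≤ N → ∀ h : ℕ, h ≠ 0 → h ≤ N →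
    ∑ p ∈ (Finset.Icc 1 N).filter (fun p => p.Prime ∧ (p + h).Prime), log ((N : ℝ) / p)
      ≤ C * N * log (log N) / (log N) ^ 2 := by
  obtain ⟨C, hC, hE⟩ := piH_bound
  refine ⟨2 * C + 648, by positivity, ?_⟩
  intro N hN h hh hhN
  have hll := loglog_ge_one N hN
  have hNr : (16 : ℝ) ≤ N := by exact_mod_cast hN
  have hN0 : (0 : ℝ) < N := by linarith
  have hlN1 : 1 ≤ log N := by
    by_contra hc
    push Not at hc
    have : 0 < log N := Real.log_pos (by linarith)
    have := Real.log_neg this hc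
    linarith
  have hl2 := Real.log_two_gt_d9
  have hl2' := Real.log_two_lt_d9
  set S := (Finset.Icc 1 N).filter (fun p => p.Prime ∧ (p + h).Prime) with hS
  set J := Nat.log 2 N + 1 with hJ
  have hJle : (J : ℝ) ≤ 3 * log N := by
    have : (2 : ℝ) ^ (Nat.log 2 N) ≤ N := by exact_mod_cast Nat.pow_log_le_self 2 (by omega)
    have h2 := Real.log_le_log (by positivity) this
    rw [Real.log_pow] at h2
    have h3 : (Nat.log 2 N : ℝ) * 0.5 ≤ log N := by
      refine le_trans ?_ h2
      gcongr
      linarith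
    rw [hJ]; push_cast
    linarith
  have key : ∀ p ∈ S, log ((N : ℝ) / p) ≤ ∑ j ∈ Finset.range J, if p ≤ N / 2 ^ j then (1 : ℝ) else 0 := by
    intro p hp
    simp only [hS, Finset.mem_filter, Finset.mem_Icc] at hp
    have hp0 : 0 < p := hp.1.1
    have hp0' : (0 : ℝ) < p := by exact_mod_cast hp0
    set L := Nat.log 2 (N / p) with hL
    have hdiv : N / p ≠ 0 := by
      have := Nat.div_pos hp.1.2 hp0
      omega
    have a1 : N < 2 ^ (L + 1) * p := by
      have := Nat.lt_pow_succ_log_self (b := 2) (by norm_num) (N / p)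
      exact (Nat.div_lt_iff_lt_mul hp0).1 this
    have a2 : log ((N : ℝ) / p) ≤ (L + 1 : ℕ) * log 2 := by
      rw [← Real.log_pow]
      apply Real.log_le_log (by positivity)
      rw [div_le_iff₀ hp0']
      exact_mod_cast a1.le
    have a3 : Finset.range (L + 1) ⊆ (Finset.range J).filter (fun j => p ≤ N / 2 ^ j) := by
      intro j hj
      simp only [Finset.mem_range, Finset.mem_filter] at hj ⊢
      have hLJ : L ≤ Nat.log 2 N := Nat.log_mono_right (Nat.div_le_self _ _)
      refine ⟨by omega, ?_⟩
      rw [Nat.le_div_iff_mul_le (by positivity)]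
      have b1 : 2 ^ j ≤ N / p := by
        refine le_trans ?_ (Nat.pow_log_le_self 2 hdiv)
        exact Nat.pow_le_pow_right (by norm_num) (by omega)
      rw [Nat.le_div_iff_mul_le hp0] at b1
      linarith
    have a4 := Finset.card_le_card a3
    rw [Finset.card_range] at a4
    have a5 : ((L + 1 : ℕ) : ℝ) ≤ (((Finset.range J).filter (fun j => p ≤ N / 2 ^ j)).card : ℝ) := by
      exact_mod_cast a4
    rw [Finset.card_filter] at a5
    push_cast at a5
    refine a2.trans (le_trans ?_ a5)
    push_cast
    nlinarith [(Nat.cast_nonneg L : (0 : ℝ) ≤ L)]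
  have hj : ∀ j ∈ Finset.range J, ∑ p ∈ S, (if p ≤ N / 2 ^ j then (1 : ℝ) else 0)
      ≤ C * N * log (log N) / (log N) ^ 2 * (1 / 2) ^ j + √(N : ℝ) := by
    intro j _
    have e1 : ∑ p ∈ S, (if p ≤ N / 2 ^ j then (1 : ℝ) else 0) ≤ piH h (N / 2 ^ j) := by
      rw [← Finset.sum_filter, Finset.sum_const, nsmul_eq_mul, mul_one]
      unfold piH
      have : (S.filter (fun p => p ≤ N / 2 ^ j)) ⊆
          (Finset.Icc 1 (N / 2 ^ j)).filter (fun p => p.Prime ∧ (p + h).Prime) := by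
        intro p hp
        simp only [hS, Finset.mem_filter, Finset.mem_Icc] at hp ⊢
        exact ⟨⟨hp.1.1.1, hp.2⟩, hp.1.2⟩
      exact_mod_cast Finset.card_le_card this
    refine e1.trans ?_
    have hXle : ((N / 2 ^ j : ℕ) : ℝ) ≤ N * (1 / 2) ^ j := by
      have := @Nat.cast_div_le ℝ _ _ _ N (2 ^ j)
      refine this.trans (le_of_eq ?_)
      push_cast
      rw [one_div, inv_pow]; rfl
    by_cases hc : √(N : ℝ) ≤ ((N / 2 ^ j : ℕ) : ℝ)
    · have := hE N hN h hh hhN _ hc (Nat.div_le_self _ _)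
      refine this.trans ?_
      have : C * ((N / 2 ^ j : ℕ) : ℝ) * log (log N) / (log N) ^ 2 ≤ C * (N * (1 / 2) ^ j) * log (log N) / (log N) ^ 2 := by
        gcongr
      refine this.trans ?_
      have := Real.sqrt_nonneg (N : ℝ)
      have e : C * (N * (1 / 2) ^ j) * log (log N) / (log N) ^ 2 = C * N * log (log N) / (log N) ^ 2 * (1 / 2) ^ j := by ring
      linarith
    · push Not at hc
      refine (piH_le h _).trans (hc.le.trans ?_)
      have : 0 ≤ C * N * log (log N) / (log N) ^ 2 * (1 / 2) ^ j := by positivity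
      linarith
  have hgeo : ∑ j ∈ Finset.range J, (1 / 2 : ℝ) ^ j ≤ 2 := sum_geometric_two_le J
  have hlog3 : (log N) ^ 3 ≤ 216 * √(N : ℝ) := by
    have h5 : log N ≤ (N : ℝ) ^ (1 / 6 : ℝ) / (1 / 6) := Real.log_le_rpow_div hN0.le (by norm_num)
    calc (log N) ^ 3 ≤ ((N : ℝ) ^ (1 / 6 : ℝ) / (1 / 6)) ^ 3 := by gcongr
      _ = 216 * √(N : ℝ) := by
        rw [div_pow, ← Real.rpow_natCast, ← Real.rpow_mul hN0.le, Real.sqrt_eq_rpow]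
        norm_num
        ring
  calc ∑ p ∈ S, log ((N : ℝ) / p)
      ≤ ∑ p ∈ S, ∑ j ∈ Finset.range J, (if p ≤ N / 2 ^ j then (1 : ℝ) else 0) := Finset.sum_le_sum key
    _ = ∑ j ∈ Finset.range J, ∑ p ∈ S, (if p ≤ N / 2 ^ j then (1 : ℝ) else 0) := Finset.sum_comm
    _ ≤ ∑ j ∈ Finset.range J, (C * N * log (log N) / (log N) ^ 2 * (1 / 2) ^ j + √(N : ℝ)) := Finset.sum_le_sum hj
    _ = C * N * log (log N) / (log N) ^ 2 * ∑ j ∈ Finset.range J, (1 / 2 : ℝ) ^ j + J * √(N : ℝ) := by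
        rw [Finset.sum_add_distrib, ← Finset.mul_sum]; simp
    _ ≤ C * N * log (log N) / (log N) ^ 2 * 2 + 3 * log N * √(N : ℝ) := by gcongr
    _ ≤ C * N * log (log N) / (log N) ^ 2 * 2 + 648 * N * log (log N) / (log N) ^ 2 := by
        gcongr
        rw [le_div_iff₀ (by positivity)]
        calc 3 * log N * √(N : ℝ) * (log N) ^ 2 = 3 * √(N : ℝ) * (log N) ^ 3 := by ring
          _ ≤ 3 * √(N : ℝ) * (216 * √(N : ℝ)) := by gcongr
          _ = 648 * N * 1 := by
            have := Real.mul_self_sqrt hN0.le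
            linear_combination 648 * this
          _ ≤ _ := by gcongr
    _ = _ := by ring
/-- pairs of primes with difference h -/
def pairsN (N : ℕ) (h : ℤ) : Finset (ℕ × ℕ) :=
  (Finset.Icc 1 N ×ˢ Finset.Icc 1 N).filter (fun q => q.1.Prime ∧ q.2.Prime ∧ (q.1 : ℤ) - q.2 = h)

/-- weighted correlation -/
noncomputable def wN (N : ℕ) (h : ℤ) : ℝ := ∑' n : ℤ, LamN N n * LamN N (n - h)

lemma LamN_nonneg (N : ℕ) (n : ℤ) : 0 ≤ LamN N n := by
  unfold LamN; split_ifs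
  · exact ArithmeticFunction.vonMangoldt_nonneg
  · exact le_rfl

lemma LamN_le (N : ℕ) (n : ℤ) : LamN N n ≤ log N := by
  unfold LamN; split_ifs with h
  · refine ArithmeticFunction.vonMangoldt_le_log.trans ?_
    apply Real.log_le_log
    · have : 0 < n.toNat := by omega
      exact_mod_cast this
    · have : n.toNat ≤ N := by omega
      exact_mod_cast this
  · exact Real.log_natCast_nonneg N

lemma wN_eq_Icc (N : ℕ) (h : ℤ) :
    wN N h = ∑ n ∈ Finset.Icc (1 : ℤ) N, LamN N n * LamN N (n - h) := by
  unfold wN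
  apply tsum_eq_sum
  intro n hn
  have : LamN N n = 0 := by
    unfold LamN
    rw [if_neg]
    simpa [Finset.mem_Icc] using hn
  rw [this, zero_mul]

lemma wN_nonneg (N : ℕ) (h : ℤ) : 0 ≤ wN N h := by
  rw [wN_eq_Icc]
  exact Finset.sum_nonneg fun n _ => mul_nonneg (LamN_nonneg _ _) (LamN_nonneg _ _)

lemma wN_le (N : ℕ) (h : ℤ) : wN N h ≤ N * (log N) ^ 2 := by
  rw [wN_eq_Icc]
  calc _ ≤ ∑ n ∈ Finset.Icc (1 : ℤ) N, (log N) ^ 2 := by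
        apply Finset.sum_le_sum
        intro n _
        rw [sq]
        exact mul_le_mul (LamN_le _ _) (LamN_le _ _) (LamN_nonneg _ _) (Real.log_natCast_nonneg N)
    _ = _ := by simp

lemma pairsN_card_le (N : ℕ) (h : ℤ) : (pairsN N h).card ≤ N := by
  have : (pairsN N h).card ≤ (Finset.Icc 1 N).card := by
    apply Finset.card_le_card_of_injOn Prod.fst
    · intro q hq
      simp only [pairsN, Finset.coe_filter, Finset.mem_product, Set.mem_ofPred_eq] at hq
      exact hq.1.1
    · rintro ⟨a, b⟩ hq ⟨a', b'⟩ hq' hab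
      simp only [pairsN, Finset.coe_filter, Set.mem_ofPred_eq] at hq hq'
      simp only at hab
      have h1 := hq.2.2.2
      have h2 := hq'.2.2.2
      ext
      · exact hab
      · simp only at *
        omega
  simpa using this

lemma triv_bound (N : ℕ) (h : ℤ) : |((pairsN N h).card : ℝ) - wN N h / (log N) ^ 2| ≤ N := by
  have h1 : ((pairsN N h).card : ℝ) ≤ N := by exact_mod_cast pairsN_card_le N h
  have h2 : wN N h / (log N) ^ 2 ≤ N := by
    apply div_le_of_le_mul₀ (by positivity) (by positivity) (wN_le N h)
  have h3 : 0 ≤ wN N h / (log N) ^ 2 := div_nonneg (wN_nonneg _ _) (by positivity)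
  have h4 : (0 : ℝ) ≤ (pairsN N h).card := by positivity
  rw [abs_le]; constructor <;> linarith

/-- base points -/
def TN (N h : ℕ) : Finset ℕ := (Finset.Icc 1 N).filter (fun m => m + h ≤ N)

lemma wN_eq_T (N h : ℕ) : wN N h = ∑ m ∈ TN N h,
    ArithmeticFunction.vonMangoldt m * ArithmeticFunction.vonMangoldt (m + h) := by
  unfold wN
  rw [tsum_eq_sum (s := (TN N h).image (fun m : ℕ => (m : ℤ) + h))]
  · rw [Finset.sum_image (by intro a _ b _ hab; simp only at hab; omega)]
    apply Finset.sum_congr rfl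
    intro m hm
    simp only [TN, Finset.mem_filter, Finset.mem_Icc] at hm
    unfold LamN
    rw [if_pos (by omega), if_pos (by omega), mul_comm]
    congr 2
    · congr 1; omega
  · intro n hn
    by_contra hc
    have h1 : LamN N n ≠ 0 := left_ne_zero_of_mul hc
    have h2 : LamN N (n - h) ≠ 0 := right_ne_zero_of_mul hc
    unfold LamN at h1 h2
    rw [ite_ne_right_iff] at h1 h2
    apply hn
    rw [Finset.mem_image]
    refine ⟨(n - h).toNat, ?_, by omega⟩
    simp only [TN, Finset.mem_filter, Finset.mem_Icc]
    omega

lemma pairs_eq_T (N h : ℕ) : (pairsN N h).card =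
    ((TN N h).filter (fun p => p.Prime ∧ (p + h).Prime)).card := by
  apply Finset.card_nbij' (fun q => q.2) (fun m => (m + h, m))
  · intro q hq
    simp only [pairsN, TN, Finset.coe_filter, Finset.mem_product, Finset.mem_filter, Finset.mem_Icc, Set.mem_ofPred_eq] at hq ⊢
    have : q.1 = q.2 + h := by omega
    rw [← this]
    exact ⟨⟨hq.1.2, hq.1.1.2⟩, hq.2.2.1, hq.2.1⟩
  · intro m hm
    simp only [pairsN, TN, Finset.coe_filter, Finset.mem_product, Finset.mem_filter, Finset.mem_Icc, Set.mem_ofPred_eq] at hm ⊢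
    refine ⟨⟨⟨by omega, by omega⟩, hm.1.1⟩, hm.2.2, hm.2.1, by push_cast; ring⟩
  · intro q hq
    simp only [pairsN, Finset.coe_filter, Set.mem_ofPred_eq] at hq
    ext
    · simp only; omega
    · rfl
  · intro m _; rfl

lemma per_d : ∃ C : ℝ, 0 < C ∧ ∀ N : ℕ, 16 ≤ N → ∀ h : ℕ, h ≠ 0 →
    |((pairsN N h).card : ℝ) - wN N h / (log N) ^ 2| ≤ C * N * log (log N) / (log N) ^ 3 := by
  obtain ⟨C, hC, hF⟩ := sum_logdiv
  refine ⟨2 * C + 864, by positivity, ?_⟩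
  intro N hN h hh
  have hll := loglog_ge_one N hN
  have hNr : (16 : ℝ) ≤ N := by exact_mod_cast hN
  have hN0 : (0 : ℝ) < N := by linarith
  have hL : 0 < log N := Real.log_pos (by linarith)
  have hpos : 0 ≤ (2 * C + 864) * N * log (log N) / (log N) ^ 3 := by positivity
  rw [wN_eq_T, pairs_eq_T]
  by_cases hhN : h ≤ N
  swap
  · have : TN N h = ∅ := by
      unfold TN
      apply Finset.filter_false_of_mem
      intro m _; omega
    rw [this]; simpa using hpos
  have hF := hF N hN h hh hhN
  set L := log N with hLdef
  set T := TN N h with hT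
  set P := T.filter (fun p => p.Prime ∧ (p + h).Prime) with hP
  set Q := T.filter (fun p => ¬ (p.Prime ∧ (p + h).Prime)) with hQ
  have hTm : ∀ m ∈ T, 1 ≤ m ∧ m ≤ N ∧ m + h ≤ N := by
    intro m hm
    simp only [hT, TN, Finset.mem_filter, Finset.mem_Icc] at hm
    omega
  have hPm : ∀ m ∈ P, m ∈ T := fun m hm => (Finset.mem_filter.1 hm).1
  have hsplit : ∑ m ∈ T, ArithmeticFunction.vonMangoldt m * ArithmeticFunction.vonMangoldt (m + h)
      = ∑ m ∈ P, log m * log ((m + h : ℕ) : ℝ) + ∑ m ∈ Q, ArithmeticFunction.vonMangoldt m * ArithmeticFunction.vonMangoldt (m + h) := by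
    rw [← Finset.sum_filter_add_sum_filter_not T (fun p => p.Prime ∧ (p + h).Prime)]
    congr 1
    apply Finset.sum_congr rfl
    intro m hm
    have := (Finset.mem_filter.1 hm).2
    rw [ArithmeticFunction.vonMangoldt_apply_prime this.1, ArithmeticFunction.vonMangoldt_apply_prime this.2]
  have hLle : ∀ n : ℕ, 1 ≤ n → n ≤ N → log n ≤ L := by
    intro n h1 h2
    apply Real.log_le_log
    · exact_mod_cast h1
    · exact_mod_cast h2
  set E := ∑ n ∈ (Finset.Icc 1 N).filter (fun n => ¬ n.Prime), ArithmeticFunction.vonMangoldt n with hE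
  have hEle : E ≤ 2 * √(N : ℝ) * L := by
    have := Chebyshev.psi_sub_theta_le (x := N) (by linarith)
    rw [Chebyshev.psi_sub_theta_eq_sum_not_prime, Nat.floor_natCast] at this
    exact this
  have hQle : ∑ m ∈ Q, ArithmeticFunction.vonMangoldt m * ArithmeticFunction.vonMangoldt (m + h) ≤ 2 * L * E := by
    have b1 : ∑ m ∈ T, (if ¬ m.Prime then ArithmeticFunction.vonMangoldt m else 0) ≤ E := by
      rw [← Finset.sum_filter]
      apply Finset.sum_le_sum_of_subset_of_nonneg
      · intro m hm
        simp only [Finset.mem_filter, Finset.mem_Icc] at hm ⊢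
        have := hTm m hm.1
        exact ⟨⟨this.1, this.2.1⟩, hm.2⟩
      · intros; exact ArithmeticFunction.vonMangoldt_nonneg
    have b2 : ∑ m ∈ T, (if ¬ (m + h).Prime then ArithmeticFunction.vonMangoldt (m + h) else 0) ≤ E := by
      rw [← Finset.sum_filter, ← Finset.sum_image (g := fun m => m + h) (f := fun n => ArithmeticFunction.vonMangoldt n) (by intro a _ b _ hab; simp only at hab; omega)]
      apply Finset.sum_le_sum_of_subset_of_nonneg
      · intro n hn
        simp only [Finset.mem_image, Finset.mem_filter, Finset.mem_Icc] at hn ⊢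
        obtain ⟨m, hm, rfl⟩ := hn
        have := hTm m hm.1
        exact ⟨⟨by omega, this.2.2⟩, hm.2⟩
      · intros; exact ArithmeticFunction.vonMangoldt_nonneg
    calc ∑ m ∈ Q, ArithmeticFunction.vonMangoldt m * ArithmeticFunction.vonMangoldt (m + h)
        ≤ ∑ m ∈ Q, L * ((if ¬ m.Prime then ArithmeticFunction.vonMangoldt m else 0) + (if ¬ (m + h).Prime then ArithmeticFunction.vonMangoldt (m + h) else 0)) := by
          apply Finset.sum_le_sum
          intro m hm
          have hm' := Finset.mem_filter.1 hm
          have ht := hTm m hm'.1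
          have c1 : ArithmeticFunction.vonMangoldt m ≤ L :=
            ArithmeticFunction.vonMangoldt_le_log.trans (hLle m ht.1 ht.2.1)
          have c2 : ArithmeticFunction.vonMangoldt (m + h) ≤ L :=
            ArithmeticFunction.vonMangoldt_le_log.trans (hLle (m + h) (by omega) ht.2.2)
          have d1 : 0 ≤ ArithmeticFunction.vonMangoldt m := ArithmeticFunction.vonMangoldt_nonneg
          have d2 : 0 ≤ ArithmeticFunction.vonMangoldt (m + h) := ArithmeticFunction.vonMangoldt_nonneg
          by_cases e1 : m.Prime
          · have e2 : ¬ (m + h).Prime := fun e => hm'.2 ⟨e1, e⟩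
            rw [if_neg (not_not.2 e1), if_pos e2]
            nlinarith
          · rw [if_pos e1]
            split_ifs <;> nlinarith
      _ ≤ ∑ m ∈ T, L * ((if ¬ m.Prime then ArithmeticFunction.vonMangoldt m else 0) + (if ¬ (m + h).Prime then ArithmeticFunction.vonMangoldt (m + h) else 0)) := by
          apply Finset.sum_le_sum_of_subset_of_nonneg (Finset.filter_subset _ _)
          intro m _ _
          have d1 : 0 ≤ ArithmeticFunction.vonMangoldt m := ArithmeticFunction.vonMangoldt_nonneg
          have d2 : 0 ≤ ArithmeticFunction.vonMangoldt (m + h) := ArithmeticFunction.vonMangoldt_nonneg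
          apply mul_nonneg hL.le
          apply add_nonneg <;> split_ifs <;> first | assumption | exact le_rfl
      _ ≤ L * (E + E) := by
          rw [← Finset.mul_sum, Finset.sum_add_distrib]
          gcongr
      _ = _ := by ring
  have hQ0 : 0 ≤ ∑ m ∈ Q, ArithmeticFunction.vonMangoldt m * ArithmeticFunction.vonMangoldt (m + h) :=
    Finset.sum_nonneg fun m _ => mul_nonneg ArithmeticFunction.vonMangoldt_nonneg ArithmeticFunction.vonMangoldt_nonneg
  have hPcard : L ^ 2 * (P.card : ℝ) = ∑ m ∈ P, L ^ 2 := by simp [mul_comm]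
  have hP1 : ∑ m ∈ P, log m * log ((m + h : ℕ) : ℝ) ≤ L ^ 2 * P.card := by
    rw [hPcard]
    apply Finset.sum_le_sum
    intro m hm
    have ht := hTm m (hPm m hm)
    rw [sq]
    exact mul_le_mul (hLle m ht.1 ht.2.1) (hLle _ (by omega) ht.2.2) (Real.log_natCast_nonneg _) hL.le
  have hP2 : L ^ 2 * P.card - ∑ m ∈ P, log m * log ((m + h : ℕ) : ℝ) ≤ 2 * L * (C * N * log L / L ^ 2) := by
    rw [hPcard, ← Finset.sum_sub_distrib]
    calc ∑ m ∈ P, (L ^ 2 - log m * log ((m + h : ℕ) : ℝ)) ≤ ∑ m ∈ P, 2 * L * log ((N : ℝ) / m) := by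
          apply Finset.sum_le_sum
          intro m hm
          have ht := hTm m (hPm m hm)
          have hm0 : (0 : ℝ) < m := by exact_mod_cast ht.1
          rw [Real.log_div hN0.ne' hm0.ne']
          have c1 : log m ≤ log ((m + h : ℕ) : ℝ) := Real.log_le_log hm0 (by push_cast; linarith [(Nat.cast_nonneg h : (0 : ℝ) ≤ h)])
          have c2 := hLle m ht.1 ht.2.1
          have c3 : 0 ≤ log (m : ℝ) := Real.log_natCast_nonneg _
          nlinarith
      _ ≤ ∑ m ∈ (Finset.Icc 1 N).filter (fun p => p.Prime ∧ (p + h).Prime), 2 * L * log ((N : ℝ) / m) := by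
          apply Finset.sum_le_sum_of_subset_of_nonneg
          · intro m hm
            have ht := hTm m (hPm m hm)
            have := (Finset.mem_filter.1 hm).2
            simp only [Finset.mem_filter, Finset.mem_Icc]
            exact ⟨⟨ht.1, ht.2.1⟩, this⟩
          · intro m hm _
            simp only [Finset.mem_filter, Finset.mem_Icc] at hm
            have hm0 : (0 : ℝ) < m := by exact_mod_cast hm.1.1
            have : 0 ≤ log ((N : ℝ) / m) := by
              apply Real.log_nonneg
              rw [le_div_iff₀ hm0, one_mul]
              exact_mod_cast hm.1.2
            positivity
      _ ≤ _ := by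
          rw [← Finset.mul_sum]
          gcongr
  have hlog3 : L ^ 3 ≤ 216 * √(N : ℝ) := by
    have h5 : log N ≤ (N : ℝ) ^ (1 / 6 : ℝ) / (1 / 6) := Real.log_le_rpow_div hN0.le (by norm_num)
    calc (log N) ^ 3 ≤ ((N : ℝ) ^ (1 / 6 : ℝ) / (1 / 6)) ^ 3 := by gcongr
      _ = 216 * √(N : ℝ) := by
        rw [div_pow, ← Real.rpow_natCast, ← Real.rpow_mul hN0.le, Real.sqrt_eq_rpow]
        norm_num
        ring
  have hEfin : 2 * L * E ≤ 864 * N * log L / L := by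
    rw [le_div_iff₀ hL]
    calc 2 * L * E * L ≤ 2 * L * (2 * √(N : ℝ) * L) * L := by gcongr
      _ = 4 * √(N : ℝ) * L ^ 3 := by ring
      _ ≤ 4 * √(N : ℝ) * (216 * √(N : ℝ)) := by gcongr
      _ = 864 * N * 1 := by
        have := Real.mul_self_sqrt hN0.le
        linear_combination 864 * this
      _ ≤ _ := by gcongr
  have e1 : 2 * L * (C * N * log L / L ^ 2) = 2 * C * N * log L / L := by field_simp
  have p1 : 0 ≤ 2 * C * N * log L / L := by positivity
  have p2 : 0 ≤ 864 * N * log L / L := by positivity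
  have fin : |L ^ 2 * (P.card : ℝ) - ∑ m ∈ T, ArithmeticFunction.vonMangoldt m * ArithmeticFunction.vonMangoldt (m + h)| ≤ 2 * C * N * log L / L + 864 * N * log L / L := by
    rw [hsplit, abs_le]
    constructor <;> linarith
  have e2 : (P.card : ℝ) - (∑ m ∈ T, ArithmeticFunction.vonMangoldt m * ArithmeticFunction.vonMangoldt (m + h)) / L ^ 2
      = (L ^ 2 * (P.card : ℝ) - ∑ m ∈ T, ArithmeticFunction.vonMangoldt m * ArithmeticFunction.vonMangoldt (m + h)) / L ^ 2 := by
    field_simp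
  rw [e2, abs_div, abs_of_pos (show 0 < L ^ 2 by positivity), div_le_iff₀ (by positivity)]
  refine fin.trans (le_of_eq ?_)
  field_simp

lemma poly_ev_pos (P : Polynomial ℝ) (h : 0 < P.leadingCoeff) :
    ∃ x0 : ℝ, ∀ x, x0 ≤ x → 0 < P.eval x := by
  by_cases hd : P.natDegree = 0
  · refine ⟨0, fun x _ => ?_⟩
    obtain ⟨a, rfl⟩ := Polynomial.natDegree_eq_zero.1 hd
    simpa using h
  · have hd' : 0 < P.degree := Polynomial.natDegree_pos_iff_degree_pos.1 (Nat.pos_of_ne_zero hd)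
    have := P.tendsto_atTop_of_leadingCoeff_nonneg hd' h.le
    exact eventually_atTop.1 (this.eventually_gt_atTop 0)

lemma eval_cast_real (f : Polynomial ℤ) (d : ℕ) :
    (f.map (Int.castRingHom ℝ)).eval (d : ℝ) = ((f.eval (d : ℤ) : ℤ) : ℝ) := by
  have := Polynomial.eval_intCast_map (Int.castRingHom ℝ) f (d : ℤ)
  simpa using this

lemma poly_inj (f : Polynomial ℤ) (k : ℕ) (hk : 1 ≤ k)
    (hdeg : f.natDegree = k) (hlead : 0 < f.leadingCoeff) :
    ∃ d0 : ℕ, (∀ d : ℕ, d0 < d → 1 ≤ f.eval (d : ℤ)) ∧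
      ∀ d d' : ℕ, d0 < d → d0 < d' → f.eval (d : ℤ) = f.eval (d' : ℤ) → d = d' := by
  set F := f.map (Int.castRingHom ℝ) with hF
  have hinj : Function.Injective (Int.castRingHom ℝ) := Int.cast_injective
  have hFl : F.leadingCoeff = f.leadingCoeff := by
    rw [hF, Polynomial.leadingCoeff_map_of_injective hinj]; simp
  have hFd : F.natDegree = k := by
    rw [hF, Polynomial.natDegree_map_eq_of_injective hinj, hdeg]
  have hFpos : 0 < F.leadingCoeff := by rw [hFl]; exact_mod_cast hlead
  have hDd : F.derivative.natDegree = k - 1 := by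
    rw [Polynomial.natDegree_derivative, hFd]
  have hDpos : 0 < F.derivative.leadingCoeff := by
    rw [Polynomial.leadingCoeff, hDd, Polynomial.coeff_derivative, Nat.sub_add_cancel hk]
    rw [Polynomial.leadingCoeff, hFd] at hFpos
    positivity
  obtain ⟨x0, h0⟩ := poly_ev_pos F hFpos
  obtain ⟨x1, h1⟩ := poly_ev_pos F.derivative hDpos
  have hmono : StrictMonoOn (fun x => F.eval x) (Set.Ici x1) := by
    apply strictMonoOn_of_deriv_pos (convex_Ici x1)
    · exact F.continuous.continuousOn
    · intro x hx
      rw [interior_Ici] at hx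
      rw [Polynomial.deriv]
      exact h1 x (le_of_lt hx)
  refine ⟨max ⌈x0⌉₊ ⌈x1⌉₊, ?_, ?_⟩
  · intro d hd
    have : 0 < F.eval (d : ℝ) := by
      apply h0
      refine (Nat.le_ceil x0).trans ?_
      have : ⌈x0⌉₊ ≤ d := (le_max_left _ _).trans hd.le
      exact_mod_cast this
    rw [hF, eval_cast_real] at this
    have : 0 < f.eval (d : ℤ) := by exact_mod_cast this
    omega
  · intro d d' hd hd' he
    have hmem : ∀ d : ℕ, max ⌈x0⌉₊ ⌈x1⌉₊ < d → (d : ℝ) ∈ Set.Ici x1 := by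
      intro d hd
      refine (Nat.le_ceil x1).trans ?_
      have : ⌈x1⌉₊ ≤ d := (le_max_right _ _).trans hd.le
      exact_mod_cast this
    have : F.eval (d : ℝ) = F.eval (d' : ℝ) := by
      rw [hF, eval_cast_real, eval_cast_real, he]
    have := hmono.injOn (hmem d hd) (hmem d' hd') this
    exact_mod_cast this

lemma poly_range (f : Polynomial ℤ) (k : ℕ) (hk : 1 ≤ k)
    (hdeg : f.natDegree = k) (hlead : 0 < f.leadingCoeff) :
    ∃ B : ℕ, ∀ N d : ℕ, 1 ≤ d → f.eval (d : ℤ) ≤ N → d ≤ Mf f k N + B := by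
  set B : ℕ := ∑ i ∈ Finset.range k, (f.coeff i).natAbs with hB
  refine ⟨B, ?_⟩
  intro N d hd hfd
  by_cases hdB : d ≤ B
  · omega
  push Not at hdB
  set c := f.leadingCoeff with hc
  have hd1 : (1 : ℤ) ≤ d := by exact_mod_cast hd
  have hdB' : (B : ℤ) ≤ d := by exact_mod_cast hdB.le
  have e1 : f.eval (d : ℤ) = (∑ i ∈ Finset.range k, f.coeff i * (d : ℤ) ^ i) + c * (d : ℤ) ^ k := by
    rw [Polynomial.eval_eq_sum_range, hdeg, Finset.sum_range_succ, hc, Polynomial.leadingCoeff, hdeg]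
  have e2 : -((B : ℤ) * (d : ℤ) ^ (k - 1)) ≤ ∑ i ∈ Finset.range k, f.coeff i * (d : ℤ) ^ i := by
    rw [hB]
    push_cast
    rw [Finset.sum_mul, ← Finset.sum_neg_distrib]
    apply Finset.sum_le_sum
    intro i hi
    have hik : i ≤ k - 1 := by have := Finset.mem_range.1 hi; omega
    have p1 : (d : ℤ) ^ i ≤ (d : ℤ) ^ (k - 1) := pow_le_pow_right₀ hd1 hik
    have p2 : 0 ≤ (d : ℤ) ^ i := by positivity
    have p3 := neg_abs_le (f.coeff i)
    have p4 := abs_nonneg (f.coeff i)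
    nlinarith
  have e3 : c * ((d : ℤ) - B) ^ k ≤ N := by
    have q1 : ((d : ℤ) - B) ^ k ≤ ((d : ℤ) - B) * (d : ℤ) ^ (k - 1) := by
      obtain ⟨j, rfl⟩ : ∃ j, k = j + 1 := ⟨k - 1, by omega⟩
      rw [Nat.add_sub_cancel, pow_succ, mul_comm]
      apply mul_le_mul_of_nonneg_left _ (by omega)
      apply pow_le_pow_left₀ (by omega) (by omega)
    have q2 : (d : ℤ) * (d : ℤ) ^ (k - 1) = (d : ℤ) ^ k := by
      rw [← pow_succ', Nat.sub_add_cancel hk]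
    have q3 : 0 ≤ (B : ℤ) * (d : ℤ) ^ (k - 1) := by positivity
    have q4 : (B : ℤ) * (d : ℤ) ^ (k - 1) ≤ c * ((B : ℤ) * (d : ℤ) ^ (k - 1)) := by nlinarith
    calc c * ((d : ℤ) - B) ^ k ≤ c * (((d : ℤ) - B) * (d : ℤ) ^ (k - 1)) :=
          mul_le_mul_of_nonneg_left q1 hlead.le
      _ = c * (d : ℤ) ^ k - c * ((B : ℤ) * (d : ℤ) ^ (k - 1)) := by rw [← q2]; ring
      _ ≤ N := by linarith
  have hc0 : (0 : ℝ) < (c : ℝ) := by exact_mod_cast hlead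
  have e4 : (c : ℝ) * ((d - B : ℕ) : ℝ) ^ k ≤ N := by
    have : c * ((d - B : ℕ) : ℤ) ^ k ≤ N := by rw [Nat.cast_sub hdB.le]; exact e3
    exact_mod_cast this
  have hk0 : k ≠ 0 := by omega
  have e5 : d - B ≤ Mf f k N := by
    unfold Mf
    apply Nat.le_floor
    calc ((d - B : ℕ) : ℝ) = (((d - B : ℕ) : ℝ) ^ k) ^ ((1 : ℝ) / k) := by
          rw [one_div, Real.pow_rpow_inv_natCast (by positivity) hk0]
      _ ≤ _ := by
          apply Real.rpow_le_rpow (by positivity) _ (by positivity)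
          rw [le_div_iff₀ hc0]
          linarith
  omega

lemma rf_upper (f : Polynomial ℤ) (N D : ℕ)
    (hD : ∀ d : ℕ, 1 ≤ d → f.eval (d : ℤ) ≤ N → d ≤ D) :
    rf f N ≤ ∑ d ∈ Finset.Icc 1 D, (pairsN N (f.eval (d : ℤ))).card := by
  classical
  have h1 : rf f N = ((Finset.Icc 1 N ×ˢ Finset.Icc 1 N).filter (fun q : ℕ × ℕ => q.1.Prime ∧ q.1 ≤ N ∧ q.2.Prime ∧ q.2 ≤ N ∧
    ∃ d : ℕ, 0 < d ∧ f.eval (d : ℤ) = (q.1 : ℤ) - (q.2 : ℤ))).card := by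
    unfold rf
    apply Nat.subtype_card
    intro q
    simp only [Finset.mem_filter, Finset.mem_product, Finset.mem_Icc]
    refine ⟨fun h => h.2, fun h => ⟨⟨⟨h.1.one_le, h.2.1⟩, h.2.2.1.one_le, h.2.2.2.1⟩, h⟩⟩
  rw [h1]
  refine le_trans (Finset.card_le_card ?_) (Finset.card_biUnion_le)
  intro q hq
  simp only [Finset.mem_filter] at hq
  obtain ⟨hm, hp1, h2, hp2, h4, d, hd, he⟩ := hq
  simp only [Finset.mem_biUnion, Finset.mem_Icc, pairsN, Finset.mem_filter]
  refine ⟨d, ⟨hd, hD d hd (by omega)⟩, hm, hp1, hp2, he.symm⟩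

lemma rf_lower (f : Polynomial ℤ) (N d0 M : ℕ)
    (hinj : ∀ d d' : ℕ, d0 < d → d0 < d' → f.eval (d : ℤ) = f.eval (d' : ℤ) → d = d') :
    ∑ d ∈ Finset.Ioc d0 M, (pairsN N (f.eval (d : ℤ))).card ≤ rf f N := by
  classical
  have h1 : rf f N = ((Finset.Icc 1 N ×ˢ Finset.Icc 1 N).filter (fun q : ℕ × ℕ => q.1.Prime ∧ q.1 ≤ N ∧ q.2.Prime ∧ q.2 ≤ N ∧
    ∃ d : ℕ, 0 < d ∧ f.eval (d : ℤ) = (q.1 : ℤ) - (q.2 : ℤ))).card := by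
    unfold rf
    apply Nat.subtype_card
    intro q
    simp only [Finset.mem_filter, Finset.mem_product, Finset.mem_Icc]
    refine ⟨fun h => h.2, fun h => ⟨⟨⟨h.1.one_le, h.2.1⟩, h.2.2.1.one_le, h.2.2.2.1⟩, h⟩⟩
  rw [h1, ← Finset.card_biUnion]
  · apply Finset.card_le_card
    intro q hq
    simp only [Finset.mem_biUnion, Finset.mem_Ioc, pairsN, Finset.mem_filter, Finset.mem_product, Finset.mem_Icc] at hq ⊢
    obtain ⟨d, hd, hm, hp1, hp2, he⟩ := hq
    exact ⟨hm, hp1, hm.1.2, hp2, hm.2.2, d, by omega, he.symm⟩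
  · intro d hd d' hd' hne
    rw [Function.onFun, Finset.disjoint_left]
    intro q hq hq'
    simp only [pairsN, Finset.mem_filter] at hq hq'
    apply hne
    simp only [Finset.coe_Ioc, Set.mem_Ioc] at hd hd'
    exact hinj d d' hd.1 hd'.1 (hq.2.2.2.symm.trans hq'.2.2.2)

theorem stmt4 (f : Polynomial ℤ) (k : ℕ) (hk : 1 ≤ k)
    (hdeg : f.natDegree = k) (hlead : 0 < f.leadingCoeff) :
    (fun N : ℕ => (rf f N : ℝ) - Rf f k N / Real.log N ^ 2)
      =O[atTop]
    (fun N : ℕ => (N : ℝ) ^ (((k : ℝ) + 1) / k) * Real.log (Real.log N) / Real.log N ^ 3) := by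
  obtain ⟨C, hC, hper⟩ := per_d
  obtain ⟨d0, hpos, hinj⟩ := poly_inj f k hk hdeg hlead
  obtain ⟨B, hB⟩ := poly_range f k hk hdeg hlead
  apply IsBigO.of_bound (C + (2 * d0 + B) * (3 * k) ^ 3)
  filter_upwards [eventually_ge_atTop 16] with N hN
  have hll := loglog_ge_one N hN
  have hNr : (16 : ℝ) ≤ N := by exact_mod_cast hN
  have hN0 : (0 : ℝ) < N := by linarith
  have hL : 0 < log N := Real.log_pos (by linarith)
  have hk0 : (0 : ℝ) < k := by exact_mod_cast hk
  have hc1 : (1 : ℝ) ≤ (f.leadingCoeff : ℝ) := by exact_mod_cast hlead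
  set M := Mf f k N with hM
  set L := log N with hLdef
  set G : ℝ := (N : ℝ) ^ (((k : ℝ) + 1) / k) * log L / L ^ 3 with hG
  have hG0 : 0 ≤ G := by positivity
  rw [Real.norm_eq_abs, Real.norm_eq_abs, abs_of_nonneg hG0]
  have hpow : (N : ℝ) ^ (((k : ℝ) + 1) / k) = N * (N : ℝ) ^ (1 / (k : ℝ)) := by
    rw [add_div, div_self hk0.ne', Real.rpow_add hN0, Real.rpow_one]
  have hMle : (M : ℝ) ≤ (N : ℝ) ^ (1 / (k : ℝ)) := by
    rw [hM]; unfold Mf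
    refine (Nat.floor_le (by positivity)).trans ?_
    apply Real.rpow_le_rpow (by positivity) _ (by positivity)
    exact div_le_self hN0.le hc1
  have hNG : (N : ℝ) ≤ (3 * k) ^ 3 * G := by
    have h5 : L ≤ (N : ℝ) ^ (1 / (3 * k) : ℝ) / (1 / (3 * k)) := Real.log_le_rpow_div hN0.le (by positivity)
    have h6 : L ^ 3 ≤ (3 * k) ^ 3 * (N : ℝ) ^ (1 / (k : ℝ)) := by
      calc L ^ 3 ≤ ((N : ℝ) ^ (1 / (3 * k) : ℝ) / (1 / (3 * k))) ^ 3 := by gcongr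
        _ = (3 * k) ^ 3 * ((N : ℝ) ^ (1 / (3 * k) : ℝ)) ^ 3 := by
          field_simp
        _ = _ := by
          rw [← Real.rpow_natCast ((N : ℝ) ^ (1 / (3 * k) : ℝ)), ← Real.rpow_mul hN0.le]
          congr 2
          push_cast
          field_simp
    rw [hG, hpow, ← mul_div_assoc, le_div_iff₀ (by positivity)]
    calc N * L ^ 3 ≤ N * ((3 * k) ^ 3 * (N : ℝ) ^ (1 / (k : ℝ))) := by gcongr
      _ = (3 * k) ^ 3 * (N * (N : ℝ) ^ (1 / (k : ℝ)) * 1) := by ring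
      _ ≤ _ := by gcongr
  set a : ℕ → ℝ := fun d => ((pairsN N (f.eval (d : ℤ))).card : ℝ) with ha
  set w : ℕ → ℝ := fun d => wN N (f.eval (d : ℤ)) with hw
  have haN : ∀ d, a d ≤ N := fun d => by
    have := pairsN_card_le N (f.eval (d : ℤ))
    simp only [ha]; exact_mod_cast this
  have ha0 : ∀ d, 0 ≤ a d := fun d => by simp only [ha]; positivity
  have hR : Rf f k N / L ^ 2 = ∑ d ∈ Finset.Icc 1 M, w d / L ^ 2 := by
    rw [← Finset.sum_div]; rfl
  have hup : (rf f N : ℝ) ≤ ∑ d ∈ Finset.Icc 1 M, a d + B * N := by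
    have := rf_upper f N (M + B) (hB N)
    have h1 : (rf f N : ℝ) ≤ ∑ d ∈ Finset.Icc 1 (M + B), a d := by
      simp only [ha]; exact_mod_cast this
    refine h1.trans ?_
    have h2 : Finset.Icc 1 (M + B) ⊆ Finset.Icc 1 M ∪ Finset.Ioc M (M + B) := by
      intro x hx
      simp only [Finset.mem_union, Finset.mem_Icc, Finset.mem_Ioc] at hx ⊢
      omega
    have h3 : Disjoint (Finset.Icc 1 M) (Finset.Ioc M (M + B)) := by
      rw [Finset.disjoint_left]
      intro x hx hx'
      simp only [Finset.mem_Icc, Finset.mem_Ioc] at hx hx'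
      omega
    calc _ ≤ ∑ d ∈ Finset.Icc 1 M ∪ Finset.Ioc M (M + B), a d :=
          Finset.sum_le_sum_of_subset_of_nonneg h2 (fun d _ _ => ha0 d)
      _ = ∑ d ∈ Finset.Icc 1 M, a d + ∑ d ∈ Finset.Ioc M (M + B), a d := Finset.sum_union h3
      _ ≤ ∑ d ∈ Finset.Icc 1 M, a d + ∑ d ∈ Finset.Ioc M (M + B), (N : ℝ) := by
          gcongr with d _; exact haN d
      _ = _ := by simp
  have hsub : Finset.Icc 1 M ⊆ Finset.Icc 1 d0 ∪ Finset.Ioc d0 M := by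
    intro x hx
    simp only [Finset.mem_union, Finset.mem_Icc, Finset.mem_Ioc] at hx ⊢
    omega
  have hdisj : Disjoint (Finset.Icc 1 d0) (Finset.Ioc d0 M) := by
    rw [Finset.disjoint_left]
    intro x hx hx'
    simp only [Finset.mem_Icc, Finset.mem_Ioc] at hx hx'
    omega
  have hlow : ∑ d ∈ Finset.Icc 1 M, a d ≤ (rf f N : ℝ) + d0 * N := by
    have := rf_lower f N d0 M hinj
    have h1 : ∑ d ∈ Finset.Ioc d0 M, a d ≤ (rf f N : ℝ) := by
      simp only [ha]; exact_mod_cast this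
    calc _ ≤ ∑ d ∈ Finset.Icc 1 d0 ∪ Finset.Ioc d0 M, a d :=
          Finset.sum_le_sum_of_subset_of_nonneg hsub (fun d _ _ => ha0 d)
      _ = ∑ d ∈ Finset.Icc 1 d0, a d + ∑ d ∈ Finset.Ioc d0 M, a d := Finset.sum_union hdisj
      _ ≤ ∑ d ∈ Finset.Icc 1 d0, (N : ℝ) + rf f N := by
          gcongr with d _; exact haN d
      _ = _ := by simp [add_comm]
  set K : ℝ := C * N * log L / L ^ 3 with hK
  have hK0 : 0 ≤ K := by positivity
  have hmid : |∑ d ∈ Finset.Icc 1 M, a d - ∑ d ∈ Finset.Icc 1 M, w d / L ^ 2| ≤ M * K + d0 * N := by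
    rw [← Finset.sum_sub_distrib]
    refine (Finset.abs_sum_le_sum_abs _ _).trans ?_
    calc _ ≤ ∑ d ∈ Finset.Icc 1 d0 ∪ Finset.Ioc d0 M, |a d - w d / L ^ 2| :=
          Finset.sum_le_sum_of_subset_of_nonneg hsub (fun d _ _ => abs_nonneg _)
      _ = ∑ d ∈ Finset.Icc 1 d0, |a d - w d / L ^ 2| + ∑ d ∈ Finset.Ioc d0 M, |a d - w d / L ^ 2| := Finset.sum_union hdisj
      _ ≤ ∑ d ∈ Finset.Icc 1 d0, (N : ℝ) + ∑ d ∈ Finset.Ioc d0 M, K := by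
          apply add_le_add
          · exact Finset.sum_le_sum fun d _ => triv_bound N _
          · apply Finset.sum_le_sum
            intro d hd
            have h1 := hpos d (Finset.mem_Ioc.1 hd).1
            have h2 := hper N hN (f.eval (d : ℤ)).toNat (by omega)
            rw [Int.toNat_of_nonneg (by omega)] at h2
            exact h2
      _ = d0 * N + ((M - d0 : ℕ) : ℝ) * K := by simp
      _ ≤ d0 * N + M * K := by
          gcongr
          exact Nat.sub_le _ _
      _ = _ := by ring
  have hMK : M * K ≤ C * G := by
    have : C * G = C * N * log L / L ^ 3 * (N : ℝ) ^ (1 / (k : ℝ)) := by rw [hG, hpow]; ring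
    rw [this, mul_comm (M : ℝ) K]
    gcongr
  rw [hR]
  have hfin : |(rf f N : ℝ) - ∑ d ∈ Finset.Icc 1 M, w d / L ^ 2| ≤ M * K + (2 * d0 + B) * N := by
    rw [abs_le] at hmid ⊢
    have b1 : (0 : ℝ) ≤ d0 * N := by positivity
    have b2 : (0 : ℝ) ≤ B * N := by positivity
    constructor <;> nlinarith [hmid.1, hmid.2]
  refine hfin.trans ?_
  have : (2 * d0 + B) * (N : ℝ) ≤ (2 * d0 + B) * ((3 * k) ^ 3 * G) := by gcongr
  nlinarith
end
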